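/- Let p = {p_i, i ∈ 𝓛} be a strictly stationary random field such that there exist s > 0 and q ≥ d with 1/s + 1/q = 1, E|p_0|^q < ∞, and ∑_{i ∈ 𝓛} α(|i|)^{1/s} < ∞, where α is the strong mixing coefficient of p. Then the perturbed lattice Ξ = {i + p_i + U : i ∈ 𝓛} is hyperuniform, i.e. Var(#(Ξ ∩ B_r))/λ^d(B_r) → 0 as r → ∞. -/

import Mathlib

open MeasureTheory ProbabilityTheory Filter

noncomputable section

/-- The strong mixing coefficient between two sub-σ-fields. -/
def alphaSigma {Ω : Type*} [MeasurableSpace Ω] (P : Measure Ω)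
    (m₁ m₂ : MeasurableSpace Ω) : ℝ :=
  sSup {x : ℝ | ∃ A B : Set Ω, MeasurableSet[m₁] A ∧ MeasurableSet[m₂] B ∧
    x = |(P A).toReal * (P B).toReal - (P (A ∩ B)).toReal|}

/-- The σ-field generated by the random variables `p i`, `i ∈ C`. -/
def sigmaGen {Ω ι F : Type*} [MeasurableSpace F] (p : ι → Ω → F) (C : Set ι) :
    MeasurableSpace Ω :=
  ⨆ i ∈ C, MeasurableSpace.comap (p i) inferInstance

/-- The strong (α-)mixing coefficient of the random field `p`, whose indices are located
at positions `pos`, evaluated at distance `n`. -/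
def mixCoef {Ω ι F : Type*} [MeasurableSpace Ω] [MeasurableSpace F]
    {d : ℕ} (P : Measure Ω) (pos : ι → EuclideanSpace ℝ (Fin d))
    (p : ι → Ω → F) (n : ℝ) : ℝ :=
  sSup {x : ℝ | ∃ A B : Finset ι,
    (∀ i ∈ A, ∀ j ∈ B, n ≤ ‖pos i - pos j‖) ∧
    x = alphaSigma P (sigmaGen p (A : Set ι)) (sigmaGen p (B : Set ι))}

namespace HU
open scoped ENNReal

variable {d : ℕ}

/-- lattice points -/
def LL (a : Fin d → EuclideanSpace ℝ (Fin d)) (m : Fin d → ℤ) : EuclideanSpace ℝ (Fin d) :=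
  ∑ i, (m i : ℝ) • a i

/-- fundamental domain -/
def DD (a : Fin d → EuclideanSpace ℝ (Fin d)) : Set (EuclideanSpace ℝ (Fin d)) :=
  {x | ∃ t : Fin d → ℝ, (∀ i, t i ∈ Set.Ico (0:ℝ) 1) ∧ x = ∑ i, t i • a i}

def bas (a : Fin d → EuclideanSpace ℝ (Fin d)) (ha : LinearIndependent ℝ a) :
    Module.Basis (Fin d) ℝ (EuclideanSpace ℝ (Fin d)) :=
  basisOfLinearIndependentOfCardEqFinrank' a ha (by simp)

lemma bas_coe (a : Fin d → EuclideanSpace ℝ (Fin d)) (ha : LinearIndependent ℝ a) :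
    ⇑(bas a ha) = a := by simp [bas]

lemma bas_repr_sum (a : Fin d → EuclideanSpace ℝ (Fin d)) (ha : LinearIndependent ℝ a)
    (t : Fin d → ℝ) (i : Fin d) : (bas a ha).repr (∑ i, t i • a i) i = t i := by
  have := (bas a ha).repr_sum_self t
  rw [bas_coe] at this
  rw [this]

lemma DD_eq (a : Fin d → EuclideanSpace ℝ (Fin d)) (ha : LinearIndependent ℝ a) :
    DD a = ZSpan.fundamentalDomain (bas a ha) := by
  ext x
  rw [ZSpan.mem_fundamentalDomain]
  constructor
  · rintro ⟨t, ht, rfl⟩ i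
    rw [bas_repr_sum]; exact ht i
  · intro h
    refine ⟨fun i => (bas a ha).repr x i, h, ?_⟩
    conv_lhs => rw [← (bas a ha).sum_repr x]
    rw [bas_coe]

lemma DD_meas (a : Fin d → EuclideanSpace ℝ (Fin d)) (ha : LinearIndependent ℝ a) :
    MeasurableSet (DD a) := by
  rw [DD_eq a ha]; exact ZSpan.fundamentalDomain_measurableSet _

lemma DD_bdd (a : Fin d → EuclideanSpace ℝ (Fin d)) (ha : LinearIndependent ℝ a) :
    Bornology.IsBounded (DD a) := by
  rw [DD_eq a ha]; exact ZSpan.fundamentalDomain_isBounded _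

lemma DD_ne_top (a : Fin d → EuclideanSpace ℝ (Fin d)) (ha : LinearIndependent ℝ a) :
    volume (DD a) ≠ ∞ := (DD_bdd a ha).measure_lt_top.ne

lemma DD_ne_zero (a : Fin d → EuclideanSpace ℝ (Fin d)) (ha : LinearIndependent ℝ a) :
    volume (DD a) ≠ 0 := by
  rw [DD_eq a ha]; exact ZSpan.measure_fundamentalDomain_ne_zero _

lemma LL_add (a : Fin d → EuclideanSpace ℝ (Fin d)) (m n : Fin d → ℤ) :
    LL a (m + n) = LL a m + LL a n := by
  simp [LL, add_smul, Finset.sum_add_distrib]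

lemma LL_zero (a : Fin d → EuclideanSpace ℝ (Fin d)) : LL a 0 = 0 := by simp [LL]

lemma LL_neg (a : Fin d → EuclideanSpace ℝ (Fin d)) (m : Fin d → ℤ) :
    LL a (-m) = - LL a m := by simp [LL]

/-- index equivalence -/
def idx (a : Fin d → EuclideanSpace ℝ (Fin d)) (ha : LinearIndependent ℝ a) :
    (Fin d → ℤ) ≃ (Submodule.span ℤ (Set.range (bas a ha))).toAddSubgroup :=
  (((bas a ha).restrictScalars ℤ).equivFun.toEquiv.symm)

lemma idx_coe (a : Fin d → EuclideanSpace ℝ (Fin d)) (ha : LinearIndependent ℝ a)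
    (m : Fin d → ℤ) : ((idx a ha m : (Submodule.span ℤ (Set.range (bas a ha))).toAddSubgroup) :
      EuclideanSpace ℝ (Fin d)) = LL a m := by
  change (((((bas a ha).restrictScalars ℤ).equivFun.symm m) :
    Submodule.span ℤ (Set.range (bas a ha))) : EuclideanSpace ℝ (Fin d)) = _
  rw [Module.Basis.equivFun_symm_apply]
  simp [LL, bas_coe, Int.cast_smul_eq_zsmul]

/-- Tiling. -/
lemma tiling (a : Fin d → EuclideanSpace ℝ (Fin d)) (ha : LinearIndependent ℝ a)
    (f : EuclideanSpace ℝ (Fin d) → ℝ≥0∞) :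
    ∫⁻ x, f x = ∑' m, ∫⁻ u in DD a, f (LL a m + u) := by
  haveI : Countable (Submodule.span ℤ (Set.range (bas a ha))).toAddSubgroup :=
    (idx a ha).symm.injective.countable
  rw [(ZSpan.isAddFundamentalDomain' (bas a ha) volume).lintegral_eq_tsum'' f, DD_eq a ha,
    ← (idx a ha).tsum_eq]
  refine tsum_congr fun m => ?_
  refine lintegral_congr fun u => ?_
  rw [← idx_coe a ha]; rfl

lemma LL_finite (a : Fin d → EuclideanSpace ℝ (Fin d)) (ha : LinearIndependent ℝ a) (R : ℝ) :
    {m | ‖LL a m‖ ≤ R}.Finite := by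
  have h := ZSpan.setFinite_inter (bas a ha)
    (Metric.isBounded_closedBall (x := (0 : EuclideanSpace ℝ (Fin d))) (r := R))
  refine Set.Finite.of_injOn (f := LL a) (t := Metric.closedBall 0 R ∩
    (Submodule.span ℤ (Set.range (bas a ha)) : Set _)) ?_ ?_ ?_
  · intro m hm
    refine ⟨by simpa using hm, ?_⟩
    rw [← idx_coe a ha]; exact (idx a ha m).2
  · intro m _ n _ hmn
    apply (idx a ha).injective
    apply Subtype.ext
    rw [idx_coe, idx_coe]; exact hmn
  · exact h


end HU

namespace HU
open scoped ENNReal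

/-! ### decay of the one-dimensional profile transform -/

def ww (n : ℕ) (t : ℝ) : ℝ := (1 - t ^ 2) ^ ((n : ℝ) / 2)

lemma ww_cont (n : ℕ) : Continuous (ww n) := by
  unfold ww
  exact (by fun_prop : Continuous fun t : ℝ => 1 - t ^ 2).rpow_const (fun _ => Or.inr (by positivity))

lemma ww_nonneg (n : ℕ) {t : ℝ} (ht : t ^ 2 ≤ 1) : 0 ≤ ww n t :=
  Real.rpow_nonneg (by linarith) _

lemma ww_le (n : ℕ) {t : ℝ} (ht : t ^ 2 ≤ 1) : ww n t ≤ 1 :=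
  Real.rpow_le_one (by linarith) (by nlinarith) (by positivity)

lemma sq_le_of_mem {t : ℝ} (ht : t ∈ Set.uIoc (-1 : ℝ) 1) : t ^ 2 ≤ 1 := by
  rw [Set.uIoc_of_le (by norm_num)] at ht
  nlinarith [ht.1, ht.2]

def C0 (n : ℕ) (l : ℝ) : ℝ := ∫ t in (-1:ℝ)..1, Real.cos (l * t) * ww n t
def C1 (n : ℕ) (l : ℝ) : ℝ := ∫ t in (-1:ℝ)..1, -(t * Real.sin (l * t)) * ww n t
def C2 (n : ℕ) (l : ℝ) : ℝ := ∫ t in (-1:ℝ)..1, -(t ^ 2 * Real.cos (l * t)) * ww n t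

lemma C0_deriv (n : ℕ) (l : ℝ) : HasDerivAt (C0 n) (C1 n l) l := by
  have hw := ww_cont n
  refine (intervalIntegral.hasDerivAt_integral_of_dominated_loc_of_deriv_le
    (F := fun l t => Real.cos (l * t) * ww n t)
    (F' := fun l t => -(t * Real.sin (l * t)) * ww n t) (bound := fun _ => 1)
    (s := Set.univ) Filter.univ_mem ?_ ?_ ?_ ?_ ?_ ?_).2
  · exact Eventually.of_forall fun l => (by fun_prop : Continuous _).aestronglyMeasurable
  · exact (by fun_prop : Continuous _).intervalIntegrable _ _
  · exact (by fun_prop : Continuous _).aestronglyMeasurable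
  · refine Eventually.of_forall fun t ht x _ => ?_
    have h2 := sq_le_of_mem ht
    rw [norm_mul, norm_neg, norm_mul, Real.norm_eq_abs, Real.norm_eq_abs, Real.norm_eq_abs,
      abs_of_nonneg (ww_nonneg n h2)]
    have h3 : |t| ≤ 1 := by rw [← sq_le_one_iff_abs_le_one]; exact h2
    exact mul_le_one₀ (mul_le_one₀ h3 (abs_nonneg _) (Real.abs_sin_le_one _)) (ww_nonneg n h2) (ww_le n h2)
  · exact intervalIntegrable_const
  · refine Eventually.of_forall fun t ht x _ => ?_
    have := ((hasDerivAt_id x).mul_const t).cos.mul_const (ww n t)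
    refine HasDerivAt.congr_deriv (f := _) this ?_
    simp only [id]; ring

lemma C1_deriv (n : ℕ) (l : ℝ) : HasDerivAt (C1 n) (C2 n l) l := by
  have hw := ww_cont n
  refine (intervalIntegral.hasDerivAt_integral_of_dominated_loc_of_deriv_le
    (F := fun l t => -(t * Real.sin (l * t)) * ww n t)
    (F' := fun l t => -(t ^ 2 * Real.cos (l * t)) * ww n t) (bound := fun _ => 1)
    (s := Set.univ) Filter.univ_mem ?_ ?_ ?_ ?_ ?_ ?_).2
  · exact Eventually.of_forall fun l => (by fun_prop : Continuous _).aestronglyMeasurable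
  · exact (by fun_prop : Continuous _).intervalIntegrable _ _
  · exact (by fun_prop : Continuous _).aestronglyMeasurable
  · refine Eventually.of_forall fun t ht x _ => ?_
    have h2 := sq_le_of_mem ht
    rw [norm_mul, norm_neg, norm_mul, Real.norm_eq_abs, Real.norm_eq_abs, Real.norm_eq_abs,
      abs_of_nonneg (ww_nonneg n h2), abs_of_nonneg (sq_nonneg t)]
    exact mul_le_one₀ (mul_le_one₀ h2 (abs_nonneg _) (Real.abs_cos_le_one _)) (ww_nonneg n h2) (ww_le n h2)
  · exact intervalIntegrable_const
  · refine Eventually.of_forall fun t ht x _ => ?_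
    have := ((((hasDerivAt_id x).mul_const t).sin.const_mul t).neg).mul_const (ww n t)
    refine HasDerivAt.congr_deriv (f := _) this ?_
    simp only [id]; ring

lemma C_ode (n : ℕ) {l : ℝ} (hl : l ≠ 0) :
    C0 n l + C2 n l = -(2 * ((n:ℝ) / 2 + 1) / l) * C1 n l := by
  have hw := ww_cont n
  have hder : ∀ t ∈ Set.uIcc (-1:ℝ) 1, HasDerivAt
      (fun t => Real.sin (l * t) / l * (1 - t ^ 2) ^ ((n : ℝ) / 2 + 1))
      (Real.cos (l * t) * ww n t + -(t ^ 2 * Real.cos (l * t)) * ww n t +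
        (2 * ((n:ℝ) / 2 + 1) / l) * (-(t * Real.sin (l * t)) * ww n t)) t := by
    intro t ht
    rw [Set.uIcc_of_le (by norm_num)] at ht
    have h0 : 0 ≤ 1 - t ^ 2 := by nlinarith [ht.1, ht.2]
    have h1 : HasDerivAt (fun t : ℝ => Real.sin (l * t) / l) (Real.cos (l * t)) t := by
      have := (((hasDerivAt_id t).const_mul l).sin).div_const l
      refine HasDerivAt.congr_deriv (f := _) this ?_
      simp; field_simp
    have h2 : HasDerivAt (fun t : ℝ => 1 - t ^ 2) (-(2 * t)) t := by
      have := ((hasDerivAt_id t).pow 2).const_sub 1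
      refine HasDerivAt.congr_deriv (f := _) this ?_
      simp
    have h3 := h2.rpow_const (p := (n:ℝ)/2 + 1) (Or.inr (by
      have : (0:ℝ) ≤ (n:ℝ)/2 := by positivity
      linarith))
    have h4 := h1.mul h3
    refine HasDerivAt.congr_deriv (f := _) h4 ?_
    have e1 : (1 - t ^ 2) ^ ((n:ℝ)/2 + 1) = ww n t * (1 - t^2) := by
      rw [Real.rpow_add_one' h0 (by positivity)]; rfl
    have e2 : (1 - t ^ 2) ^ ((n:ℝ)/2 + 1 - 1) = ww n t := by
      unfold ww; congr 1; ring
    rw [e1, e2]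
    ring
  have hi := intervalIntegral.integral_eq_sub_of_hasDerivAt hder
    ((by fun_prop : Continuous _).intervalIntegrable _ _)
  have hz : (0:ℝ) ^ ((n:ℝ)/2+1) = 0 := Real.zero_rpow (by positivity)
  rw [intervalIntegral.integral_add ((by fun_prop : Continuous _).intervalIntegrable _ _)
    ((by fun_prop : Continuous _).intervalIntegrable _ _),
    intervalIntegral.integral_add ((by fun_prop : Continuous _).intervalIntegrable _ _)
    ((by fun_prop : Continuous _).intervalIntegrable _ _),
    intervalIntegral.integral_const_mul] at hi
  norm_num [hz] at hi
  have hi' : C0 n l + C2 n l + (2 * ((n:ℝ) / 2 + 1) / l) * C1 n l = 0 := by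
    unfold C0 C1 C2
    rw [← hi]; simp
  linarith

lemma C0_decay (n : ℕ) : ∃ C : ℝ, 0 < C ∧ ∀ l : ℝ, 0 < l →
    |C0 n l| * l ^ ((n:ℝ) / 2 + 1) ≤ C := by
  set b : ℝ := (n:ℝ)/2 + 1 with hb
  have hb1 : 1 ≤ b := by rw [hb]; have : (0:ℝ) ≤ (n:ℝ)/2 := by positivity
                         linarith
  set c : ℝ := b * (b - 1) with hc
  have hc0 : 0 ≤ c := mul_nonneg (by linarith) (by linarith)
  set ps : ℝ → ℝ := fun l => l ^ b * C0 n l with hps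
  set dp : ℝ → ℝ := fun l => b * l ^ (b-1) * C0 n l + l ^ b * C1 n l with hdp
  have h1 : ∀ l : ℝ, 0 < l → HasDerivAt ps (dp l) l := by
    intro l hl
    exact (Real.hasDerivAt_rpow_const (Or.inl hl.ne')).mul (C0_deriv n l)
  have h2 : ∀ l : ℝ, 0 < l → HasDerivAt dp (-ps l + c / l ^ 2 * ps l) l := by
    intro l hl
    have := (((Real.hasDerivAt_rpow_const (x := l) (p := b-1) (Or.inl hl.ne')).const_mul b).mul
      (C0_deriv n l)).add ((Real.hasDerivAt_rpow_const (x := l) (p := b) (Or.inl hl.ne')).mul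
        (C1_deriv n l))
    refine HasDerivAt.congr_deriv (f := _) this ?_
    have ho := C_ode n hl.ne'
    rw [← hb] at ho
    have ho' : C2 n l = -C0 n l -(2 * b / l) * C1 n l := by linarith
    rw [ho']
    have e1 : l ^ (b-1) = l ^ b / l := Real.rpow_sub_one hl.ne' b
    have e2 : l ^ (b-1-1) = l ^ b / l / l := by rw [Real.rpow_sub_one hl.ne', e1]
    simp only [hps, hc, e1, e2]
    field_simp
    ring
  set K : ℝ → ℝ := fun l => Real.exp (c / l) * (ps l ^ 2 + dp l ^ 2) with hK
  have h3 : ∀ l : ℝ, 0 < l → HasDerivAt K (Real.exp (c / l) * (-c / l ^ 2) * (ps l ^ 2 + dp l ^ 2) +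
      Real.exp (c / l) * (2 * ps l * dp l + 2 * dp l * (-ps l + c / l ^ 2 * ps l))) l := by
    intro l hl
    have e1 : HasDerivAt (fun l => c / l) (-c / l ^ 2) l := by
      have := (hasDerivAt_inv hl.ne').const_mul c
      refine HasDerivAt.congr_deriv (f := _) this ?_
      ring
    have := e1.exp.mul (((h1 l hl).pow 2).add ((h2 l hl).pow 2))
    refine HasDerivAt.congr_deriv (f := _) this ?_
    simp
  have hanti : AntitoneOn K (Set.Ici 1) := by
    have hpos : ∀ l ∈ Set.Ici (1:ℝ), 0 < l := fun l hl => lt_of_lt_of_le one_pos hl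
    refine antitoneOn_of_deriv_nonpos (convex_Ici 1)
      (fun l hl => (h3 l (hpos l hl)).continuousAt.continuousWithinAt) ?_ ?_
    · intro l hl
      exact (h3 l (hpos l (interior_subset hl))).differentiableAt.differentiableWithinAt
    · intro l hl
      have hl0 := hpos l (interior_subset hl)
      rw [(h3 l hl0).deriv]
      have : Real.exp (c / l) * (-c / l ^ 2) * (ps l ^ 2 + dp l ^ 2) +
        Real.exp (c / l) * (2 * ps l * dp l + 2 * dp l * (-ps l + c / l ^ 2 * ps l)) =
        - (Real.exp (c/l) * (c / l^2) * (ps l - dp l)^2) := by ring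
      rw [this, neg_nonpos]
      positivity
  have hbd : ∀ l : ℝ, |C0 n l| ≤ 2 := by
    intro l
    have := intervalIntegral.norm_integral_le_of_norm_le_const (a := -1) (b := 1) (C := 1)
      (f := fun t => Real.cos (l * t) * ww n t) (by
        intro t ht
        have h2 := sq_le_of_mem ht
        rw [norm_mul, Real.norm_eq_abs, Real.norm_eq_abs, abs_of_nonneg (ww_nonneg n h2)]
        exact mul_le_one₀ (Real.abs_cos_le_one _) (ww_nonneg n h2) (ww_le n h2))
    norm_num at this
    exact this
  refine ⟨2 + (K 1 + 1), by have : 0 ≤ K 1 := by positivity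
                            linarith, ?_⟩
  intro l hl
  have hK1 : 0 ≤ K 1 := by positivity
  rcases le_total 1 l with h | h
  · have h5 := hanti (Set.mem_Ici.2 le_rfl) (Set.mem_Ici.2 h) h
    have h6 : ps l ^ 2 ≤ K l := by
      have : 1 ≤ Real.exp (c / l) := Real.one_le_exp (by positivity)
      simp only [hK]
      nlinarith [sq_nonneg (ps l), sq_nonneg (dp l)]
    have h7 : |C0 n l| * l ^ b = |ps l| := by
      rw [hps]; simp only; rw [abs_mul, abs_of_pos (Real.rpow_pos_of_pos hl b), mul_comm]
    rw [h7]
    nlinarith [sq_abs (ps l), abs_nonneg (ps l), sq_nonneg (|ps l| - 1)]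
  · have : l ^ b ≤ 1 := Real.rpow_le_one hl.le h (by linarith)
    have h0 : 0 ≤ l ^ b := Real.rpow_nonneg hl.le _
    nlinarith [hbd l, abs_nonneg (C0 n l)]

end HU

namespace HU
open scoped ENNReal

def slice (n : ℕ) : EuclideanSpace ℝ (Fin (n+1)) ≃ᵐ ℝ × EuclideanSpace ℝ (Fin n) :=
  ((MeasurableEquiv.toLp 2 (Fin (n+1) → ℝ)).symm.trans
    (MeasurableEquiv.piFinSuccAbove (fun _ => ℝ) 0)).trans
    (MeasurableEquiv.prodCongr (MeasurableEquiv.refl ℝ) (MeasurableEquiv.toLp 2 (Fin n → ℝ)))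

lemma slice_mp (n : ℕ) : MeasurePreserving (slice n) := by
  refine MeasurePreserving.trans (MeasurePreserving.trans ?_
    (volume_preserving_piFinSuccAbove (fun _ => ℝ) 0)) ?_
  · exact EuclideanSpace.volume_preserving_symm_measurableEquiv_toLp (Fin (n+1))
  · exact (MeasurePreserving.id _).prod
      (EuclideanSpace.volume_preserving_symm_measurableEquiv_toLp (Fin n)).symm

lemma slice_fst (n : ℕ) (x : EuclideanSpace ℝ (Fin (n+1))) : (slice n x).1 = x 0 := rfl

lemma slice_norm (n : ℕ) (x : EuclideanSpace ℝ (Fin (n+1))) :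
    ‖x‖ ^ 2 = (slice n x).1 ^ 2 + ‖(slice n x).2‖ ^ 2 := by
  rw [EuclideanSpace.norm_sq_eq, EuclideanSpace.norm_sq_eq, Fin.sum_univ_succ]
  simp only [Real.norm_eq_abs, sq_abs]
  rfl

lemma slice_int (n : ℕ) (F : ℝ → ℝ) (hF : Continuous F) :
    ∫ x in Metric.closedBall (0 : EuclideanSpace ℝ (Fin (n+1))) 1, F (x 0) =
    (volume (Metric.ball (0 : EuclideanSpace ℝ (Fin n)) 1)).toReal *
      ∫ t in (-1:ℝ)..1, F t * ww n t := by
  set κ := (volume (Metric.ball (0 : EuclideanSpace ℝ (Fin n)) 1)).toReal with hκ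
  set S : Set (ℝ × EuclideanSpace ℝ (Fin n)) := {z | z.1 ^ 2 + ‖z.2‖ ^ 2 ≤ 1} with hS
  have hSm : MeasurableSet S := by
    apply IsClosed.measurableSet
    exact isClosed_le (by fun_prop) continuous_const
  have h1 : slice n ⁻¹' S = Metric.closedBall (0 : EuclideanSpace ℝ (Fin (n+1))) 1 := by
    ext x
    simp only [hS, Set.mem_preimage, Set.mem_ofPred_eq, ← slice_norm, Metric.mem_closedBall,
      dist_zero_right]
    rw [sq_le_one_iff₀ (norm_nonneg _)]
  rw [← h1]
  have h2 := (slice_mp n).setIntegral_preimage_emb (slice n).measurableEmbedding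
    (fun z => F z.1) S
  simp only [slice_fst] at h2
  rw [h2, ← integral_indicator hSm]
  have hSfin : volume S ≠ ∞ := by
    rw [← (slice_mp n).measure_preimage hSm.nullMeasurableSet, h1]
    exact measure_closedBall_lt_top.ne
  have hIntg : Integrable (S.indicator fun z => F z.1) (volume.prod volume) := by
    obtain ⟨C, hC⟩ := (isCompact_Icc (a := (-1:ℝ)) (b := 1)).exists_bound_of_continuousOn
      hF.continuousOn
    rw [integrable_indicator_iff hSm]
    refine Measure.integrableOn_of_bounded (M := C) hSfin (by fun_prop) ?_
    refine (ae_restrict_iff' hSm).2 (Eventually.of_forall fun z hz => hC _ ?_)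
    have : z.1 ^ 2 ≤ 1 := by
      have : z.1 ^ 2 + ‖z.2‖ ^ 2 ≤ 1 := hz
      nlinarith [sq_nonneg ‖z.2‖]
    exact abs_le.1 (sq_le_one_iff_abs_le_one _ |>.1 this)
  rw [show (volume : Measure (ℝ × EuclideanSpace ℝ (Fin n))) = volume.prod volume from rfl,
    integral_prod _ hIntg]
  have h3 : ∀ t : ℝ, ∫ y, S.indicator (fun z => F z.1) (t, y) =
      (Set.Icc (-1:ℝ) 1).indicator (fun t => κ * (F t * ww n t)) t := by
    intro t
    by_cases ht : t ∈ Set.Icc (-1:ℝ) 1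
    · have h0 : 0 ≤ 1 - t ^ 2 := by nlinarith [ht.1, ht.2]
      rw [Set.indicator_of_mem ht]
      have : (fun y => S.indicator (fun z => F z.1) (t, y)) =
          (Metric.closedBall (0 : EuclideanSpace ℝ (Fin n)) (√(1 - t^2))).indicator
            (fun _ => F t) := by
        ext y
        have hiff : (t, y) ∈ S ↔ y ∈ Metric.closedBall (0 : EuclideanSpace ℝ (Fin n)) (√(1 - t^2)) := by
          simp only [hS, Set.mem_ofPred_eq, Metric.mem_closedBall, dist_zero_right]
          rw [Real.le_sqrt (norm_nonneg _) h0]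
          constructor <;> intro h <;> linarith
        by_cases hy : (t, y) ∈ S
        · rw [Set.indicator_of_mem hy, Set.indicator_of_mem (hiff.1 hy)]
        · rw [Set.indicator_of_notMem hy, Set.indicator_of_notMem (fun h => hy (hiff.2 h))]
      rw [this, integral_indicator_const _ Metric.isClosed_closedBall.measurableSet,
        Measure.real, Measure.addHaar_closedBall _ _ (Real.sqrt_nonneg _), ENNReal.toReal_mul,
        ENNReal.toReal_ofReal (by positivity), finrank_euclideanSpace_fin, ← hκ]
      have : √(1 - t ^ 2) ^ n = ww n t := by
        rw [ww, Real.sqrt_eq_rpow, ← Real.rpow_natCast, ← Real.rpow_mul h0]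
        congr 1; ring
      rw [this, smul_eq_mul]; ring
    · rw [Set.indicator_of_notMem ht]
      have : (fun y => S.indicator (fun z => F z.1) (t, y)) = fun _ => 0 := by
        ext y
        apply Set.indicator_of_notMem
        intro hz
        apply ht
        have h' : t ^ 2 + ‖y‖ ^ 2 ≤ 1 := hz
        have : t ^ 2 ≤ 1 := by nlinarith [sq_nonneg ‖y‖]
        exact abs_le.1 (sq_le_one_iff_abs_le_one _ |>.1 this)
      rw [this]; simp
  simp_rw [h3]
  rw [integral_indicator measurableSet_Icc, integral_const_mul, integral_Icc_eq_integral_Ioc,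
    intervalIntegral.integral_of_le (by norm_num)]

lemma ball_cos_unit (n : ℕ) (ξ : EuclideanSpace ℝ (Fin (n+1))) (hξ : ξ ≠ 0) :
    ∫ x in Metric.closedBall (0 : EuclideanSpace ℝ (Fin (n+1))) 1, Real.cos (inner ℝ ξ x) =
    (volume (Metric.ball (0 : EuclideanSpace ℝ (Fin n)) 1)).toReal * C0 n ‖ξ‖ := by
  set u : EuclideanSpace ℝ (Fin (n+1)) := ‖ξ‖⁻¹ • ξ with hu
  have hξn : ‖ξ‖ ≠ 0 := norm_ne_zero_iff.2 hξ
  have hu1 : ‖u‖ = 1 := by rw [hu, norm_smul, norm_inv, norm_norm, inv_mul_cancel₀ hξn]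
  obtain ⟨b, hb⟩ := Orthonormal.exists_orthonormalBasis_extension_of_card_eq
    (𝕜 := ℝ) (E := EuclideanSpace ℝ (Fin (n+1))) (ι := Fin (n+1)) (by simp)
    (v := fun _ => u) (s := {0}) (by
      refine ⟨fun _ => hu1, fun i j hij => ?_⟩
      exact absurd (Subsingleton.elim i j) hij)
  have hb0 : b 0 = u := hb 0 rfl
  have hmp := b.measurePreserving_repr
  have hF := slice_int n (fun t => Real.cos (‖ξ‖ * t)) (by fun_prop)
  have h2 := hmp.setIntegral_preimage_emb (b.repr.toHomeomorph.measurableEmbedding)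
    (fun z => Real.cos (‖ξ‖ * z 0)) (Metric.closedBall (0 : EuclideanSpace ℝ (Fin (n+1))) 1)
  rw [hF] at h2
  unfold C0
  rw [← h2]
  have h3 : b.repr ⁻¹' (Metric.closedBall (0 : EuclideanSpace ℝ (Fin (n+1))) 1) =
      Metric.closedBall (0 : EuclideanSpace ℝ (Fin (n+1))) 1 := by
    ext x; simp
  rw [h3]
  refine integral_congr_ae (Eventually.of_forall fun x => ?_)
  simp only
  rw [b.repr_apply_apply, hb0, hu, inner_smul_left]
  simp only [map_inv₀, conj_trivial]
  rw [← mul_assoc, mul_inv_cancel₀ hξn, one_mul]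

lemma ball_cos (n : ℕ) (ξ : EuclideanSpace ℝ (Fin (n+1))) (hξ : ξ ≠ 0) {r : ℝ} (hr : 0 < r) :
    ∫ x in Metric.closedBall (0 : EuclideanSpace ℝ (Fin (n+1))) r, Real.cos (inner ℝ ξ x) =
    r ^ (n+1) * ((volume (Metric.ball (0 : EuclideanSpace ℝ (Fin n)) 1)).toReal * C0 n (r * ‖ξ‖)) := by
  have h := Measure.setIntegral_comp_smul_of_pos volume
    (fun x => Real.cos (inner ℝ ξ x)) (Metric.closedBall (0 : EuclideanSpace ℝ (Fin (n+1))) 1) hr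
  rw [smul_unitClosedBall_of_nonneg hr.le, finrank_euclideanSpace_fin] at h
  have h2 := ball_cos_unit n (r • ξ) (smul_ne_zero hr.ne' hξ)
  simp only [inner_smul_right] at h
  simp only [inner_smul_left, conj_trivial] at h2
  rw [h2, norm_smul, Real.norm_of_nonneg hr.le, smul_eq_mul] at h
  rw [h]
  field_simp

/-- decay of the Fourier transform of the ball. -/
lemma ball_cos_decay (d : ℕ) (hd : 1 ≤ d) : ∃ C : ℝ, 0 < C ∧ ∀ (ξ : EuclideanSpace ℝ (Fin d)), ξ ≠ 0 →
    ∀ r : ℝ, 0 < r →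
    (∫ x in Metric.closedBall (0 : EuclideanSpace ℝ (Fin d)) r, Real.cos (inner ℝ ξ x)) ^ 2 ≤
      C * (r ^ d) ^ 2 * (r * ‖ξ‖) ^ (-((d:ℝ) + 1)) := by
  obtain ⟨n, rfl⟩ : ∃ n, d = n + 1 := ⟨d - 1, by omega⟩
  obtain ⟨C, hC, h⟩ := C0_decay n
  set κ := (volume (Metric.ball (0 : EuclideanSpace ℝ (Fin n)) 1)).toReal with hκ
  refine ⟨κ ^ 2 * C ^ 2 + 1, by positivity, fun ξ hξ r hr => ?_⟩
  rw [ball_cos n ξ hξ hr, ← hκ]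
  have hl : 0 < r * ‖ξ‖ := mul_pos hr (norm_pos_iff.2 hξ)
  set l := r * ‖ξ‖
  have h1 := h l hl
  have h2 : (C0 n l) ^ 2 * l ^ (((n:ℝ) + 1) + 1) ≤ C ^ 2 := by
    have e : l ^ (((n:ℝ) + 1) + 1) = (l ^ ((n:ℝ)/2 + 1)) ^ 2 := by
      rw [← Real.rpow_natCast, ← Real.rpow_mul hl.le]; congr 1; push_cast; ring
    rw [e, ← sq_abs (C0 n l), ← mul_pow]
    exact pow_le_pow_left₀ (by positivity) h1 2
  have hp : 0 < l ^ (((n:ℝ) + 1) + 1) := Real.rpow_pos_of_pos hl _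
  push_cast
  rw [Real.rpow_neg hl.le]
  have h3 : (C0 n l) ^ 2 ≤ C ^ 2 * (l ^ (((n:ℝ) + 1) + 1))⁻¹ := by
    rw [← div_eq_mul_inv, le_div_iff₀ hp]; exact h2
  have hi : 0 < (l ^ (((n:ℝ) + 1) + 1))⁻¹ := inv_pos.2 hp
  calc (r ^ (n+1) * (κ * C0 n l)) ^ 2 = (r ^ (n+1)) ^ 2 * κ ^ 2 * (C0 n l) ^ 2 := by ring
    _ ≤ (r ^ (n+1)) ^ 2 * κ ^ 2 * (C ^ 2 * (l ^ (((n:ℝ) + 1) + 1))⁻¹) := by gcongr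
    _ ≤ _ := by
      have : 0 ≤ (r ^ (n+1)) ^ 2 * (l ^ (((n:ℝ) + 1) + 1))⁻¹ := by positivity
      nlinarith

end HU

namespace HU
open scoped ENNReal

section Torus

local instance instMSC : MeasureSpace UnitAddCircle := ⟨AddCircle.haarAddCircle⟩

local instance instHaarC : Measure.IsAddHaarMeasure (volume : Measure UnitAddCircle) :=
  inferInstanceAs (Measure.IsAddHaarMeasure AddCircle.haarAddCircle)

local instance instProbC : IsProbabilityMeasure (volume : Measure UnitAddCircle) :=
  inferInstanceAs (IsProbabilityMeasure AddCircle.haarAddCircle)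

def cube (d : ℕ) : Set (Fin d → ℝ) := {t | ∀ i, t i ∈ Set.Ioc (0:ℝ) 1}

lemma cube_meas (d : ℕ) : MeasurableSet (cube d) := by
  have : cube d = Set.univ.pi fun _ => Set.Ioc (0:ℝ) 1 := by ext; simp [cube]
  rw [this]
  exact MeasurableSet.univ_pi fun _ => measurableSet_Ioc

def rep {d : ℕ} (x : UnitAddTorus (Fin d)) : Fin d → ℝ :=
  (UnitAddTorus.measurableEquivPiIoc (fun _ => (0:ℝ)) x).1

lemma rep_meas {d : ℕ} : Measurable (rep (d := d)) :=
  measurable_subtype_coe.comp (UnitAddTorus.measurableEquivPiIoc (fun _ => (0:ℝ))).measurable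

lemma rep_coe {d : ℕ} {t : Fin d → ℝ} (ht : t ∈ cube d) :
    rep (fun i => (t i : UnitAddCircle)) = t := by
  have h : ∀ i, t i ∈ Set.Ioc ((fun _ : Fin d => (0:ℝ)) i) ((fun _ : Fin d => (0:ℝ)) i + 1) := by
    intro i; simpa using ht i
  have := (UnitAddTorus.measurableEquivPiIoc (fun _ : Fin d => (0:ℝ))).apply_symm_apply ⟨t, h⟩
  exact congrArg Subtype.val this

lemma parseval_cube {d : ℕ} (f : (Fin d → ℝ) → ℝ) (hf : Measurable f) (C : ℝ)
    (hC : ∀ t, |f t| ≤ C) :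
    HasSum (fun n : Fin d → ℤ => ‖∫ t in cube d,
      Complex.exp (-(2 * Real.pi * Complex.I * ∑ i, (n i : ℂ) * (t i : ℂ))) * (f t : ℂ)‖ ^ 2)
      (∫ t in cube d, f t ^ 2) := by
  set F : UnitAddTorus (Fin d) → ℂ := fun x => (f (rep x) : ℂ) with hF
  have hFm : Measurable F := Complex.measurable_ofReal.comp (hf.comp rep_meas)
  have hmem : MemLp F 2 (volume : Measure (UnitAddTorus (Fin d))) := by
    refine MemLp.of_bound hFm.aestronglyMeasurable C (Eventually.of_forall fun x => ?_)
    simp only [hF, Complex.norm_real, Real.norm_eq_abs]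
    exact hC _
  have hcube : {x : Fin d → ℝ | ∀ i, x i ∈ Set.Ioc ((fun _ : Fin d => (0:ℝ)) i)
      ((fun _ : Fin d => (0:ℝ)) i + 1)} = cube d := by
    ext x; simp [cube]
  set G := MemLp.toLp F hmem with hG
  have hGF : G =ᵐ[volume] F := hmem.coeFn_toLp
  have h := UnitAddTorus.hasSum_sq_mFourierCoeff G
  have hIntg : ∫ t, ‖G t‖ ^ 2 = ∫ t in cube d, f t ^ 2 := by
    have e1 : ∫ t, ‖G t‖ ^ 2 = ∫ t, ‖F t‖ ^ 2 := by
      refine integral_congr_ae ?_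
      filter_upwards [hGF] with x hx
      rw [hx]
    rw [e1, UnitAddTorus.integral_preimage _ (fun _ => (0:ℝ)), hcube]
    refine setIntegral_congr_fun (cube_meas d) fun t ht => ?_
    simp only [hF]
    rw [rep_coe ht, Complex.norm_real, Real.norm_eq_abs, sq_abs]
  rw [hIntg] at h
  convert h using 3 with n
  congr 1
  have e2 : UnitAddTorus.mFourierCoeff G n = UnitAddTorus.mFourierCoeff F n := by
    refine integral_congr_ae ?_
    filter_upwards [hGF] with x hx
    rw [hx]
  rw [e2, UnitAddTorus.mFourierCoeff_eq_integral _ _ (fun _ => (0:ℝ)), hcube]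
  refine setIntegral_congr_fun (cube_meas d) fun t ht => ?_
  simp only [hF]
  rw [rep_coe ht, smul_eq_mul]
  congr 1
  simp only [UnitAddTorus.mFourier, ContinuousMap.coe_mk, fourier_coe_apply]
  rw [← Complex.exp_sum]
  congr 1
  rw [Finset.mul_sum, ← Finset.sum_neg_distrib]
  refine Finset.sum_congr rfl fun i _ => ?_
  simp
  ring

end Torus

end HU

namespace HU
open scoped ENNReal

variable {d : ℕ}

/-- indicator of the ball, extended nonnegative valued -/
def ind (r : ℝ) : EuclideanSpace ℝ (Fin d) → ℝ≥0∞ :=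
  (Metric.closedBall (0 : EuclideanSpace ℝ (Fin d)) r).indicator 1

lemma ind_meas (r : ℝ) : Measurable (ind (d := d) r) :=
  measurable_one.indicator Metric.isClosed_closedBall.measurableSet

lemma ind_le (r : ℝ) (x : EuclideanSpace ℝ (Fin d)) : ind r x ≤ 1 :=
  Set.indicator_le_self' (fun _ _ => zero_le_one) x

def GG (r : ℝ) (y : EuclideanSpace ℝ (Fin d)) : ℝ≥0∞ := ∫⁻ z, ind r z * ind r (z + y)

lemma GG_shift (r : ℝ) (x y : EuclideanSpace ℝ (Fin d)) :
    ∫⁻ z, ind r (z + x) * ind r (z + y) = GG r (y - x) := by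
  have h := lintegral_add_right_eq_self (μ := volume)
    (fun z : EuclideanSpace ℝ (Fin d) => ind r z * ind r (z + (y - x))) x
  rw [GG, ← h]
  refine lintegral_congr fun z => ?_
  congr 2
  abel

lemma GG_le (r : ℝ) (y : EuclideanSpace ℝ (Fin d)) :
    GG r y ≤ volume (Metric.closedBall (0 : EuclideanSpace ℝ (Fin d)) r) := by
  calc GG r y ≤ ∫⁻ z, ind r z := by
        refine lintegral_mono fun z => ?_
        calc ind r z * ind r (z + y) ≤ ind r z * 1 := by gcongr; exact ind_le _ _
          _ = ind r z := mul_one _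
    _ = _ := lintegral_indicator_one Metric.isClosed_closedBall.measurableSet

lemma GG_meas (r : ℝ) : Measurable (GG (d := d) r) := by
  unfold GG
  refine Measurable.lintegral_prod_right' (f := fun q : _ × _ => ind r q.2 * ind r (q.2 + q.1)) ?_
  exact ((ind_meas r).comp measurable_snd).mul
    ((ind_meas r).comp (measurable_snd.add measurable_fst))

lemma unfold_sum (a : Fin d → EuclideanSpace ℝ (Fin d)) (ha : LinearIndependent ℝ a)
    (f g : EuclideanSpace ℝ (Fin d) → ℝ≥0∞) (hf : Measurable f) (hg : Measurable g) :
    ∑' k, ∫⁻ z, f z * g (z + LL a k) =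
      ∫⁻ u in DD a, (∑' m, f (LL a m + u)) * (∑' m, g (LL a m + u)) := by
  have h1 : ∀ k, ∫⁻ z, f z * g (z + LL a k) =
      ∫⁻ u in DD a, ∑' m, f (LL a m + u) * g (LL a m + u + LL a k) := by
    intro k
    rw [tiling a ha, lintegral_tsum]
    intro m
    exact ((hf.comp (measurable_const_add _)).mul
      (hg.comp ((measurable_const_add _).add_const _))).aemeasurable
  simp_rw [h1]
  rw [← lintegral_tsum]
  · refine lintegral_congr fun u => ?_
    rw [ENNReal.tsum_comm, ← ENNReal.tsum_mul_right]
    refine tsum_congr fun m => ?_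
    rw [← ENNReal.tsum_mul_left, ← (Equiv.addLeft m).tsum_eq
      (fun n => f (LL a m + u) * g (LL a n + u))]
    refine tsum_congr fun k => ?_
    simp only [Equiv.coe_addLeft, LL_add]
    congr 2
    abel
  · intro k
    refine (Measurable.ennreal_tsum fun m => ?_).aemeasurable
    exact ((hf.comp (measurable_const_add _)).mul
      (hg.comp ((measurable_const_add _).add_const _)))

lemma two_mul_le_sq (x y : ℝ≥0∞) : 2 * (x * y) ≤ x * x + y * y := by
  rcases eq_or_ne x ∞ with rfl | hx
  · simp
  rcases eq_or_ne y ∞ with rfl | hy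
  · simp
  lift x to NNReal using hx
  lift y to NNReal using hy
  norm_cast
  have := two_mul_le_add_sq (x:ℝ) (y:ℝ)
  have h2 : (2:ℝ) * (x * y) ≤ x * x + y * y := by nlinarith
  exact_mod_cast h2

/-- shifted lattice sums are dominated by the unshifted one -/
lemma sum_GG_shift_le (a : Fin d → EuclideanSpace ℝ (Fin d)) (ha : LinearIndependent ℝ a)
    (r : ℝ) (w : EuclideanSpace ℝ (Fin d)) :
    ∑' k, GG r (LL a k + w) ≤ ∑' k, GG r (LL a k) := by
  have hm := ind_meas (d := d) r
  have hmw : Measurable fun z : EuclideanSpace ℝ (Fin d) => ind r (z + w) :=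
    hm.comp (measurable_add_const w)
  have e0 : ∑' k, GG r (LL a k) = ∫⁻ u in DD a, (∑' m, ind r (LL a m + u)) *
      (∑' m, ind r (LL a m + u)) := unfold_sum a ha _ _ hm hm
  have e1 : ∑' k, GG r (LL a k) = ∫⁻ u in DD a, (∑' m, ind r (LL a m + u + w)) *
      (∑' m, ind r (LL a m + u + w)) := by
    rw [← unfold_sum a ha (fun z => ind r (z + w)) (fun z => ind r (z + w)) hmw hmw]
    refine tsum_congr fun k => ?_
    have := GG_shift r w (LL a k + w)
    rw [add_sub_cancel_right] at this
    rw [← this]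
    refine lintegral_congr fun z => ?_
    congr 2; abel
  have e2 : ∑' k, GG r (LL a k + w) = ∫⁻ u in DD a, (∑' m, ind r (LL a m + u)) *
      (∑' m, ind r (LL a m + u + w)) := by
    rw [← unfold_sum a ha (fun z => ind r z) (fun z => ind r (z + w)) hm hmw]
    refine tsum_congr fun k => ?_
    unfold GG
    refine lintegral_congr fun z => ?_
    congr 2; abel
  have h : 2 * ∑' k, GG r (LL a k + w) ≤ 2 * ∑' k, GG r (LL a k) := by
    rw [two_mul (∑' k, GG r (LL a k))]
    nth_rewrite 1 [e0]
    rw [e1, e2, ← lintegral_const_mul' _ _ (by norm_num), ← lintegral_add_left]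
    · exact lintegral_mono fun u => two_mul_le_sq _ _
    · refine Measurable.mul ?_ ?_ <;>
      exact Measurable.ennreal_tsum fun m => hm.comp (measurable_const_add _)
  exact (ENNReal.mul_le_mul_iff_right (by norm_num) (by norm_num)).1 h

end HU

namespace HU
open scoped ENNReal

variable {d : ℕ}

def AA (a : Fin d → EuclideanSpace ℝ (Fin d)) (ha : LinearIndependent ℝ a) :
    (Fin d → ℝ) ≃L[ℝ] EuclideanSpace ℝ (Fin d) := (bas a ha).equivFunL.symm

lemma AA_apply (a : Fin d → EuclideanSpace ℝ (Fin d)) (ha : LinearIndependent ℝ a)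
    (t : Fin d → ℝ) : AA a ha t = ∑ i, t i • a i := by
  have : AA a ha t = (bas a ha).equivFun.symm t := rfl
  rw [this, Module.Basis.equivFun_symm_apply, bas_coe]

lemma AA_preim (a : Fin d → EuclideanSpace ℝ (Fin d)) (ha : LinearIndependent ℝ a) :
    AA a ha ⁻¹' DD a = Set.univ.pi fun _ => Set.Ico (0:ℝ) 1 := by
  ext t
  simp only [Set.mem_preimage, Set.mem_univ_pi, AA_apply]
  constructor
  · rintro ⟨s, hs, h⟩ i
    have := congrArg (fun x => (bas a ha).repr x i) h
    simp only [bas_repr_sum] at this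
    rw [this]; exact hs i
  · intro h
    exact ⟨t, h, rfl⟩

lemma AA_measure (a : Fin d → EuclideanSpace ℝ (Fin d)) (ha : LinearIndependent ℝ a) :
    (volume : Measure (EuclideanSpace ℝ (Fin d))) =
      volume (DD a) • Measure.map (AA a ha) volume := by
  have h := Measure.isAddLeftInvariant_eq_smul
    (volume : Measure (EuclideanSpace ℝ (Fin d))) (Measure.map (AA a ha) volume)
  set c := Measure.addHaarScalarFactor
    (volume : Measure (EuclideanSpace ℝ (Fin d))) (Measure.map (AA a ha) volume) with hc
  have h1 : volume (DD a) = c := by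
    conv_lhs => rw [h]
    rw [Measure.smul_apply, Measure.map_apply (AA a ha).continuous.measurable (DD_meas a ha),
      AA_preim, Real.volume_pi_Ico]
    simp
  rw [h1]
  exact h

lemma AA_restrict (a : Fin d → EuclideanSpace ℝ (Fin d)) (ha : LinearIndependent ℝ a) :
    (volume : Measure (EuclideanSpace ℝ (Fin d))).restrict (DD a) =
      volume (DD a) • Measure.map (AA a ha) (volume.restrict (cube d)) := by
  have h1 : (volume : Measure (EuclideanSpace ℝ (Fin d))).restrict (DD a) =
      (volume (DD a) • Measure.map (AA a ha) volume).restrict (DD a) := by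
    rw [← AA_measure]
  rw [h1, Measure.restrict_smul, Measure.restrict_map (AA a ha).continuous.measurable (DD_meas a ha),
    AA_preim]
  congr 2
  refine Measure.restrict_congr_set ?_
  have hc : cube d = Set.univ.pi fun _ => Set.Ioc (0:ℝ) 1 := by ext; simp [cube]
  rw [hc]
  exact Measure.univ_pi_Ico_ae_eq_Icc.trans Measure.univ_pi_Ioc_ae_eq_Icc.symm

lemma AA_emb (a : Fin d → EuclideanSpace ℝ (Fin d)) (ha : LinearIndependent ℝ a) :
    MeasurableEmbedding (AA a ha) :=
  (AA a ha).toHomeomorph.measurableEmbedding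

lemma AA_lintegral (a : Fin d → EuclideanSpace ℝ (Fin d)) (ha : LinearIndependent ℝ a)
    (f : EuclideanSpace ℝ (Fin d) → ℝ≥0∞) :
    ∫⁻ u in DD a, f u = volume (DD a) * ∫⁻ t in cube d, f (AA a ha t) := by
  rw [AA_restrict a ha, lintegral_smul_measure, (AA_emb a ha).lintegral_map]; rfl

lemma AA_integral (a : Fin d → EuclideanSpace ℝ (Fin d)) (ha : LinearIndependent ℝ a)
    (f : EuclideanSpace ℝ (Fin d) → ℂ) :
    ∫ u in DD a, f u = (volume (DD a)).toReal • ∫ t in cube d, f (AA a ha t) := by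
  rw [AA_restrict a ha, integral_smul_measure, (AA_emb a ha).integral_map]

/-- dual basis -/
def dua (a : Fin d → EuclideanSpace ℝ (Fin d)) (ha : LinearIndependent ℝ a) (i : Fin d) :
    EuclideanSpace ℝ (Fin d) :=
  (InnerProductSpace.toDual ℝ (EuclideanSpace ℝ (Fin d))).symm
    (LinearMap.toContinuousLinearMap ((bas a ha).coord i))

lemma dua_inner (a : Fin d → EuclideanSpace ℝ (Fin d)) (ha : LinearIndependent ℝ a) (i : Fin d)
    (t : Fin d → ℝ) : inner ℝ (dua a ha i) (∑ i, t i • a i) = t i := by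
  rw [dua, InnerProductSpace.toDual_symm_apply]
  exact bas_repr_sum a ha t i

lemma dua_li (a : Fin d → EuclideanSpace ℝ (Fin d)) (ha : LinearIndependent ℝ a) :
    LinearIndependent ℝ (dua a ha) := by
  rw [Fintype.linearIndependent_iff]
  intro g hg j
  have h := congrArg (fun x => inner ℝ x (∑ i, (Pi.single j 1 : Fin d → ℝ) i • a i)) hg
  simp only [sum_inner, inner_smul_left, dua_inner, inner_zero_left] at h
  simpa [Pi.single_apply] using h

lemma dua_LL (a : Fin d → EuclideanSpace ℝ (Fin d)) (ha : LinearIndependent ℝ a)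
    (n : Fin d → ℤ) (t : Fin d → ℝ) :
    inner ℝ (LL (dua a ha) n) (AA a ha t) = ∑ i, (n i : ℝ) * t i := by
  rw [LL, AA_apply]
  simp only [sum_inner, inner_smul_left, dua_inner]
  simp

lemma LL_inj (a : Fin d → EuclideanSpace ℝ (Fin d)) (ha : LinearIndependent ℝ a) :
    Function.Injective (LL a) := by
  intro m n hmn
  apply (idx a ha).injective
  apply Subtype.ext
  rw [idx_coe, idx_coe]; exact hmn

lemma LL_summable (a : Fin d → EuclideanSpace ℝ (Fin d)) (ha : LinearIndependent ℝ a) :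
    Summable fun n : Fin d → ℤ => ‖LL a n‖ ^ (-((d:ℝ) + 1)) := by
  have h := ZLattice.summable_norm_rpow (Submodule.span ℤ (Set.range (bas a ha)))
    (-((d:ℝ)+1)) (by rw [ZLattice.rank ℝ]; simp)
  have h2 := ((idx a ha).summable_iff (f := fun z : (Submodule.span ℤ (Set.range (bas a ha))).toAddSubgroup => ‖(z : EuclideanSpace ℝ (Fin d))‖ ^ (-((d:ℝ)+1)))).2 h
  refine h2.congr fun n => ?_
  simp only [Function.comp, idx_coe]

lemma tiling_int (a : Fin d → EuclideanSpace ℝ (Fin d)) (ha : LinearIndependent ℝ a)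
    (f : EuclideanSpace ℝ (Fin d) → ℂ) (hf : Integrable f) :
    ∫ x, f x = ∑' m, ∫ u in DD a, f (LL a m + u) := by
  haveI : Countable (Submodule.span ℤ (Set.range (bas a ha))).toAddSubgroup :=
    (idx a ha).symm.injective.countable
  rw [(ZSpan.isAddFundamentalDomain' (bas a ha) volume).integral_eq_tsum'' f hf, DD_eq a ha,
    ← (idx a ha).tsum_eq]
  refine tsum_congr fun m => ?_
  congr 1
  ext u
  rw [← idx_coe a ha]; rfl

end HU

namespace HU
open scoped ENNReal

variable {d : ℕ}

/-- real indicator of the ball -/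
def rin (r : ℝ) : EuclideanSpace ℝ (Fin d) → ℝ :=
  (Metric.closedBall (0 : EuclideanSpace ℝ (Fin d)) r).indicator (fun _ => (1:ℝ))

lemma rin_meas (r : ℝ) : Measurable (rin (d := d) r) :=
  measurable_const.indicator Metric.isClosed_closedBall.measurableSet

lemma rin_nonneg (r : ℝ) (x : EuclideanSpace ℝ (Fin d)) : 0 ≤ rin r x :=
  Set.indicator_nonneg (fun _ _ => zero_le_one) x

lemma rin_le (r : ℝ) (x : EuclideanSpace ℝ (Fin d)) : rin r x ≤ 1 :=
  Set.indicator_le_self' (fun _ _ => zero_le_one) x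

lemma ofReal_rin (r : ℝ) (x : EuclideanSpace ℝ (Fin d)) : ENNReal.ofReal (rin r x) = ind r x := by
  unfold rin ind
  by_cases h : x ∈ Metric.closedBall (0 : EuclideanSpace ℝ (Fin d)) r
  · simp [Set.indicator_of_mem h]
  · simp [Set.indicator_of_notMem h]

lemma rin_zero (r : ℝ) (x : EuclideanSpace ℝ (Fin d)) (h : r < ‖x‖) : rin r x = 0 := by
  unfold rin
  apply Set.indicator_of_notMem
  simpa using h

lemma ind_zero (r : ℝ) (x : EuclideanSpace ℝ (Fin d)) (h : r < ‖x‖) : ind r x = 0 := by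
  rw [← ofReal_rin, rin_zero r x h]; simp

def RR (a : Fin d → EuclideanSpace ℝ (Fin d)) : ℝ := ∑ i, ‖a i‖

lemma norm_comb_le (a : Fin d → EuclideanSpace ℝ (Fin d)) (t : Fin d → ℝ)
    (ht : ∀ i, |t i| ≤ 1) : ‖∑ i, t i • a i‖ ≤ RR a := by
  refine (norm_sum_le _ _).trans (Finset.sum_le_sum fun i _ => ?_)
  rw [norm_smul, Real.norm_eq_abs]
  exact mul_le_of_le_one_left (norm_nonneg _) (ht i)

def TT (a : Fin d → EuclideanSpace ℝ (Fin d)) (ha : LinearIndependent ℝ a) (r : ℝ) :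
    Finset (Fin d → ℤ) := (LL_finite a ha (r + RR a)).toFinset

lemma TT_out (a : Fin d → EuclideanSpace ℝ (Fin d)) (ha : LinearIndependent ℝ a) (r : ℝ)
    (m : Fin d → ℤ) (hm : m ∉ TT a ha r) (t : Fin d → ℝ) (ht : ∀ i, |t i| ≤ 1) :
    r < ‖LL a m + ∑ i, t i • a i‖ := by
  simp only [TT, Set.Finite.mem_toFinset, Set.mem_ofPred_eq, not_le] at hm
  have h1 := norm_comb_le a t ht
  have h2 := norm_sub_le (LL a m + ∑ i, t i • a i) (∑ i, t i • a i)
  rw [add_sub_cancel_right] at h2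
  linarith

def ff (a : Fin d → EuclideanSpace ℝ (Fin d)) (ha : LinearIndependent ℝ a) (r : ℝ)
    (t : Fin d → ℝ) : ℝ := ∑ m ∈ TT a ha r, rin r (LL a m + AA a ha t)

lemma ff_meas (a : Fin d → EuclideanSpace ℝ (Fin d)) (ha : LinearIndependent ℝ a) (r : ℝ) :
    Measurable (ff a ha r) := by
  unfold ff
  exact Finset.measurable_fun_sum _ fun m _ => (rin_meas r).comp
    ((AA a ha).continuous.measurable.const_add _)

lemma ff_nonneg (a : Fin d → EuclideanSpace ℝ (Fin d)) (ha : LinearIndependent ℝ a) (r : ℝ)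
    (t : Fin d → ℝ) : 0 ≤ ff a ha r t := Finset.sum_nonneg fun _ _ => rin_nonneg _ _

lemma ff_bdd (a : Fin d → EuclideanSpace ℝ (Fin d)) (ha : LinearIndependent ℝ a) (r : ℝ)
    (t : Fin d → ℝ) : |ff a ha r t| ≤ (TT a ha r).card := by
  rw [abs_of_nonneg (ff_nonneg a ha r t)]
  unfold ff
  calc _ ≤ ∑ m ∈ TT a ha r, (1:ℝ) := Finset.sum_le_sum fun _ _ => rin_le _ _
    _ = _ := by simp

lemma cube_abs {t : Fin d → ℝ} (ht : t ∈ cube d) (i : Fin d) : |t i| ≤ 1 := by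
  have := ht i
  rw [abs_le]; constructor <;> linarith [this.1, this.2]

lemma ff_tsum (a : Fin d → EuclideanSpace ℝ (Fin d)) (ha : LinearIndependent ℝ a) (r : ℝ)
    (t : Fin d → ℝ) (ht : t ∈ cube d) :
    ∑' m, ind r (LL a m + AA a ha t) = ENNReal.ofReal (ff a ha r t) := by
  rw [ff, ENNReal.ofReal_sum_of_nonneg fun _ _ => rin_nonneg _ _]
  simp_rw [ofReal_rin]
  refine tsum_eq_sum fun m hm => ?_
  apply ind_zero
  rw [AA_apply]
  exact TT_out a ha r m hm t (cube_abs ht)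

lemma cube_vol : volume (cube d) = 1 := by
  have hc : cube d = Set.univ.pi fun _ => Set.Ioc (0:ℝ) 1 := by ext; simp [cube]
  rw [hc, Real.volume_pi_Ioc]; simp

instance cube_fin : IsFiniteMeasure (volume.restrict (cube d)) :=
  ⟨by rw [Measure.restrict_apply_univ, cube_vol]; exact ENNReal.one_lt_top⟩

lemma sum_GG_eq (a : Fin d → EuclideanSpace ℝ (Fin d)) (ha : LinearIndependent ℝ a) (r : ℝ) :
    ∑' k, GG r (LL a k) = volume (DD a) * ENNReal.ofReal (∫ t in cube d, ff a ha r t ^ 2) := by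
  have h := unfold_sum a ha _ _ (ind_meas (d := d) r) (ind_meas r)
  change ∑' k, GG r (LL a k) = _ at h
  rw [h, AA_lintegral a ha]
  congr 1
  rw [ofReal_integral_eq_lintegral_ofReal]
  · refine setLIntegral_congr_fun (cube_meas d) fun t ht => ?_
    rw [ff_tsum a ha r t ht, ← ENNReal.ofReal_mul (ff_nonneg _ _ _ _), sq]
  · refine Integrable.of_bound ((ff_meas a ha r).pow_const 2).aestronglyMeasurable
      (((TT a ha r).card : ℝ)^2) (ae_of_all _ fun t => ?_)
    rw [Real.norm_eq_abs, abs_pow]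
    exact pow_le_pow_left₀ (abs_nonneg _) (ff_bdd a ha r t) 2
  · exact ae_of_all _ fun t => sq_nonneg _

def HH (r : ℝ) (η x : EuclideanSpace ℝ (Fin d)) : ℂ :=
  Complex.exp (-(2 * Real.pi * Complex.I * ((inner ℝ η x : ℝ) : ℂ))) * (rin r x : ℂ)

lemma HH_meas (r : ℝ) (η : EuclideanSpace ℝ (Fin d)) : Measurable (HH r η) := by
  unfold HH
  refine Measurable.mul ?_ (Complex.measurable_ofReal.comp (rin_meas r))
  exact Continuous.measurable (by fun_prop)

lemma HH_norm (r : ℝ) (η x : EuclideanSpace ℝ (Fin d)) : ‖HH r η x‖ = rin r x := by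
  unfold HH
  rw [norm_mul, Complex.norm_exp]
  simp [abs_of_nonneg (rin_nonneg r x)]

lemma rin_int (r : ℝ) : Integrable (rin (d := d) r) := by
  unfold rin
  refine IntegrableOn.integrable_indicator ?_ Metric.isClosed_closedBall.measurableSet
  exact integrableOn_const (measure_closedBall_lt_top).ne

lemma HH_int (r : ℝ) (η : EuclideanSpace ℝ (Fin d)) : Integrable (HH r η) :=
  (rin_int r).mono' (HH_meas r η).aestronglyMeasurable (ae_of_all _ fun x => (HH_norm r η x).le)

lemma HH_integral (r : ℝ) (η : EuclideanSpace ℝ (Fin d)) :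
    ∫ x, HH r η x = ((∫ x in Metric.closedBall (0 : EuclideanSpace ℝ (Fin d)) r,
      Real.cos (inner ℝ ((2 * Real.pi) • η) x) : ℝ) : ℂ) := by
  have h1 : ∀ x, HH r η x + HH r η (-x) =
      ((2 * (rin r x * Real.cos (inner ℝ ((2 * Real.pi) • η) x)) : ℝ) : ℂ) := by
    intro x
    have hr : rin r (-x) = rin r x := by
      unfold rin Set.indicator; simp
    unfold HH
    rw [hr, inner_neg_right, inner_smul_left]
    push_cast
    rw [Complex.cos]
    simp only [conj_trivial, Complex.ofReal_mul, Complex.ofReal_ofNat]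
    rw [show (-(2 * (Real.pi:ℂ) * Complex.I * ((inner ℝ η x : ℝ) : ℂ))) =
      -(2 * (Real.pi:ℂ) * ((inner ℝ η x : ℝ) : ℂ)) * Complex.I by ring,
      show (-(2 * (Real.pi:ℂ) * Complex.I * -((inner ℝ η x : ℝ) : ℂ))) =
      (2 * (Real.pi:ℂ) * ((inner ℝ η x : ℝ) : ℂ)) * Complex.I by ring]
    ring
  have h2 : ∫ x, HH r η (-x) = ∫ x, HH r η x := integral_neg_eq_self _ _
  have h3 : ∫ x, (HH r η x + HH r η (-x)) = 2 * ∫ x, HH r η x := by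
    rw [integral_add (HH_int r η) (HH_int r η).comp_neg, h2]; ring
  simp_rw [h1] at h3
  rw [integral_complex_ofReal, integral_const_mul] at h3
  have h4 : ∫ x, rin r x * Real.cos (inner ℝ ((2 * Real.pi) • η) x) =
      ∫ x in Metric.closedBall (0 : EuclideanSpace ℝ (Fin d)) r,
      Real.cos (inner ℝ ((2 * Real.pi) • η) x) := by
    rw [← integral_indicator Metric.isClosed_closedBall.measurableSet]
    congr 1
    ext x
    unfold rin Set.indicator
    split_ifs <;> simp
  rw [h4] at h3
  push_cast at h3 ⊢
  exact (mul_left_cancel₀ two_ne_zero h3).symm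

lemma exp_per (a : Fin d → EuclideanSpace ℝ (Fin d)) (ha : LinearIndependent ℝ a) (r : ℝ)
    (n m : Fin d → ℤ) (t : Fin d → ℝ) :
    Complex.exp (-(2 * Real.pi * Complex.I * ∑ i, (n i:ℂ) * (t i:ℂ))) *
      (rin r (LL a m + AA a ha t) : ℂ) = HH r (LL (dua a ha) n) (LL a m + AA a ha t) := by
  unfold HH
  congr 1
  have hm : LL a m = AA a ha (fun i => (m i : ℝ)) := by rw [AA_apply]; rfl
  rw [inner_add_right, dua_LL, hm, dua_LL]
  have : -(2 * (Real.pi:ℂ) * Complex.I * (((∑ i, (n i:ℝ) * (m i:ℝ)) + ∑ i, (n i:ℝ) * t i : ℝ) : ℂ))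
      = -(2 * Real.pi * Complex.I * ∑ i, (n i:ℂ) * (t i:ℂ)) +
        ((-(∑ i, n i * m i) : ℤ) : ℂ) * (2 * Real.pi * Complex.I) := by
    push_cast; ring
  rw [this, Complex.exp_add, Complex.exp_int_mul_two_pi_mul_I, mul_one]

lemma coef_eq (a : Fin d → EuclideanSpace ℝ (Fin d)) (ha : LinearIndependent ℝ a) (r : ℝ)
    (n : Fin d → ℤ) :
    (volume (DD a)).toReal • ∫ t in cube d,
      Complex.exp (-(2 * Real.pi * Complex.I * ∑ i, (n i:ℂ) * (t i:ℂ))) * (ff a ha r t : ℂ) =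
    ∫ x, HH r (LL (dua a ha) n) x := by
  have h1 : ∫ t in cube d,
      Complex.exp (-(2 * Real.pi * Complex.I * ∑ i, (n i:ℂ) * (t i:ℂ))) * (ff a ha r t : ℂ) =
      ∑ m ∈ TT a ha r, ∫ t in cube d, HH r (LL (dua a ha) n) (LL a m + AA a ha t) := by
    rw [← integral_finsetSum]
    · congr 1
      ext t
      rw [ff]
      push_cast
      rw [Finset.mul_sum]
      exact Finset.sum_congr rfl fun m _ => exp_per a ha r n m t
    · intro m _
      refine Integrable.of_bound (C := 1) ((HH_meas r _).comp
        ((AA a ha).continuous.measurable.const_add _)).aestronglyMeasurable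
        (ae_of_all _ fun t => ?_)
      rw [HH_norm]; exact rin_le _ _
  rw [h1, Finset.smul_sum, tiling_int a ha _ (HH_int r _)]
  rw [Finset.sum_congr rfl fun m _ =>
    (AA_integral a ha (fun u => HH r (LL (dua a ha) n) (LL a m + u))).symm]
  symm
  refine tsum_eq_sum fun m hm => ?_
  refine setIntegral_eq_zero_of_forall_eq_zero fun u hu => ?_
  obtain ⟨t, ht, rfl⟩ := hu
  rw [← norm_eq_zero, HH_norm]
  apply rin_zero
  refine TT_out a ha r m hm t fun i => ?_
  rw [abs_le]; constructor <;> linarith [(ht i).1, (ht i).2]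

lemma rpow_aux (hd : 1 ≤ d) (r x : ℝ) (hr : 1 ≤ r) (hx : 0 ≤ x) :
    (r ^ d) ^ 2 * (r * ((2 * Real.pi) * x)) ^ (-((d:ℝ) + 1)) ≤
      r ^ (d - 1) * x ^ (-((d:ℝ) + 1)) := by
  have hr0 : (0:ℝ) < r := by linarith
  have hpi := Real.pi_gt_three
  rw [Real.mul_rpow hr0.le (by positivity), Real.mul_rpow (by positivity) hx]
  have h1 : (2 * Real.pi) ^ (-((d:ℝ) + 1)) ≤ 1 :=
    Real.rpow_le_one_of_one_le_of_nonpos (by linarith) (by linarith [Nat.cast_nonneg (α := ℝ) d])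
  have h2 : (r ^ d) ^ 2 * r ^ (-((d:ℝ) + 1)) = r ^ (d - 1) := by
    rw [Real.rpow_neg hr0.le, show ((d:ℝ) + 1) = ((d + 1 : ℕ) : ℝ) by push_cast; ring,
      Real.rpow_natCast]
    rw [← div_eq_mul_inv, div_eq_iff (by positivity), ← pow_mul, ← pow_add]
    congr 1
    omega
  have h3 : 0 ≤ x ^ (-((d:ℝ) + 1)) := Real.rpow_nonneg hx _
  rw [← mul_assoc, h2]
  have h4 : 0 ≤ r ^ (d - 1) := by positivity
  exact mul_le_mul_of_nonneg_left (mul_le_of_le_one_left h3 h1) h4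

/-- Lattice count variance bound. -/
lemma lattice_bound (hd : 1 ≤ d) (a : Fin d → EuclideanSpace ℝ (Fin d))
    (ha : LinearIndependent ℝ a) :
    ∃ K : ℝ, 0 ≤ K ∧ ∀ r : ℝ, 1 ≤ r → ∑' k, GG r (LL a k) ≤
      volume (DD a) * ENNReal.ofReal
        (((volume (Metric.closedBall (0 : EuclideanSpace ℝ (Fin d)) r)).toReal /
          (volume (DD a)).toReal) ^ 2 + K * r ^ (d - 1)) := by
  obtain ⟨C, hC, hdec⟩ := ball_cos_decay d hd
  set v := (volume (DD a)).toReal with hv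
  have hv0 : 0 < v := ENNReal.toReal_pos (DD_ne_zero a ha) (DD_ne_top a ha)
  set S := ∑' n : Fin d → ℤ, ‖LL (dua a ha) n‖ ^ (-((d:ℝ) + 1)) with hS
  have hsum := LL_summable (dua a ha) (dua_li a ha)
  have hS0 : 0 ≤ S := tsum_nonneg fun n => Real.rpow_nonneg (norm_nonneg _) _
  refine ⟨C / v ^ 2 * S, by positivity, fun r hr => ?_⟩
  rw [sum_GG_eq a ha]
  gcongr
  have hr0 : (0:ℝ) < r := by linarith
  set V := (volume (Metric.closedBall (0 : EuclideanSpace ℝ (Fin d)) r)).toReal with hV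
  have hP := parseval_cube (ff a ha r) (ff_meas a ha r) _ (ff_bdd a ha r)
  have hg1 : HasSum (fun n : Fin d → ℤ => if n = 0 then (V / v) ^ 2 else 0) ((V / v) ^ 2) :=
    hasSum_ite_eq 0 _
  have hg2 : HasSum (fun n : Fin d → ℤ => C / v ^ 2 * r ^ (d - 1) *
      ‖LL (dua a ha) n‖ ^ (-((d:ℝ) + 1))) (C / v ^ 2 * r ^ (d - 1) * S) :=
    hsum.hasSum.mul_left _
  have hle := hasSum_le (fun n => ?_) hP (hg1.add hg2)
  · calc _ ≤ _ := hle
      _ = _ := by ring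
  have hcoef := coef_eq a ha r n
  rw [HH_integral] at hcoef
  set J := ∫ x in Metric.closedBall (0 : EuclideanSpace ℝ (Fin d)) r,
      Real.cos (inner ℝ ((2 * Real.pi) • LL (dua a ha) n) x) with hJ
  set c := ∫ t in cube d,
      Complex.exp (-(2 * Real.pi * Complex.I * ∑ i, (n i:ℂ) * (t i:ℂ))) * (ff a ha r t : ℂ) with hc
  have hnorm : v * ‖c‖ = |J| := by
    have := congrArg norm hcoef
    rw [norm_smul, Complex.norm_real, Real.norm_eq_abs, Real.norm_eq_abs, abs_of_pos hv0] at this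
    exact this
  have hc2 : ‖c‖ ^ 2 = J ^ 2 / v ^ 2 := by
    rw [← sq_abs J, ← hnorm]; field_simp
  rw [hc2]
  have hnn : 0 ≤ ‖LL (dua a ha) n‖ ^ (-((d:ℝ) + 1)) := Real.rpow_nonneg (norm_nonneg _) _
  by_cases hn : n = 0
  · have : J = V := by
      rw [hJ, hn, LL_zero]
      simp [hV, Measure.real]
    rw [if_pos hn, this, div_pow]
    have : 0 ≤ C / v ^ 2 * r ^ (d - 1) * ‖LL (dua a ha) n‖ ^ (-((d:ℝ) + 1)) := by positivity
    linarith
  · rw [if_neg hn, zero_add]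
    have hne : LL (dua a ha) n ≠ 0 := by
      intro h
      exact hn (LL_inj (dua a ha) (dua_li a ha) (by rw [h, LL_zero]))
    have hpi := Real.pi_pos
    have h1 := hdec ((2 * Real.pi) • LL (dua a ha) n)
      (smul_ne_zero (by positivity) hne) r hr0
    rw [norm_smul, Real.norm_eq_abs, abs_of_pos (by positivity : 0 < 2 * Real.pi)] at h1
    have h2 := rpow_aux hd r ‖LL (dua a ha) n‖ hr (norm_nonneg _)
    calc J ^ 2 / v ^ 2 ≤ (C * (r ^ (d - 1) * ‖LL (dua a ha) n‖ ^ (-((d:ℝ) + 1)))) / v ^ 2 := by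
          gcongr
          refine h1.trans ?_
          rw [mul_assoc]
          exact mul_le_mul_of_nonneg_left h2 hC.le
      _ = _ := by ring

end HU

namespace HU
open scoped ENNReal Pointwise

variable {d : ℕ}

lemma sign_choice {ι : Type*} [DecidableEq ι] (m : ι → ι → ℝ) (T : Finset ι) :
    ∃ e : ι → ℝ, (∀ i, e i = 1 ∨ e i = -1) ∧
      ∑ i ∈ T, m i i ≤ ∑ i ∈ T, ∑ j ∈ T, e i * e j * m i j := by
  induction T using Finset.induction_on with
  | empty => exact ⟨fun _ => 1, fun _ => Or.inl rfl, by simp⟩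
  | insert k T hk ih =>
    obtain ⟨e, he, hle⟩ := ih
    have key : ∀ s : ℝ, s = 1 ∨ s = -1 → ∃ e' : ι → ℝ, (∀ i, e' i = 1 ∨ e' i = -1) ∧
        ∑ i ∈ insert k T, ∑ j ∈ insert k T, e' i * e' j * m i j =
          m k k + s * (∑ j ∈ T, e j * (m k j + m j k)) + ∑ i ∈ T, ∑ j ∈ T, e i * e j * m i j := by
      intro s hs
      have hs2 : s * s = 1 := by rcases hs with rfl | rfl <;> norm_num
      refine ⟨Function.update e k s, fun i => ?_, ?_⟩
      · by_cases h : i = k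
        · subst h; simpa using hs
        · simpa [Function.update_of_ne h] using he i
      · have hu : ∀ i ∈ T, Function.update e k s i = e i := fun i hi =>
          Function.update_of_ne (ne_of_mem_of_not_mem hi hk) _ _
        rw [Finset.sum_insert hk, Finset.sum_insert hk]
        have h1 : ∑ j ∈ T, Function.update e k s k * Function.update e k s j * m k j =
            s * ∑ j ∈ T, e j * m k j := by
          rw [Finset.mul_sum]
          refine Finset.sum_congr rfl fun j hj => ?_
          rw [hu j hj, Function.update_self]; ring
        have h2 : ∑ i ∈ T, ∑ j ∈ insert k T,
            Function.update e k s i * Function.update e k s j * m i j =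
            s * ∑ j ∈ T, e j * m j k + ∑ i ∈ T, ∑ j ∈ T, e i * e j * m i j := by
          rw [Finset.mul_sum, ← Finset.sum_add_distrib]
          refine Finset.sum_congr rfl fun i hi => ?_
          rw [Finset.sum_insert hk, hu i hi, Function.update_self]
          congr 1
          · ring
          · exact Finset.sum_congr rfl fun j hj => by rw [hu j hj]
        rw [h1, h2, Function.update_self, hs2]
        simp only [mul_add, Finset.sum_add_distrib]
        ring
    rw [Finset.sum_insert hk]
    rcases le_total 0 (∑ j ∈ T, e j * (m k j + m j k)) with h | h
    · obtain ⟨e', he', heq⟩ := key 1 (Or.inl rfl)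
      exact ⟨e', he', by rw [heq]; linarith⟩
    · obtain ⟨e', he', heq⟩ := key (-1) (Or.inr rfl)
      exact ⟨e', he', by rw [heq]; linarith⟩

lemma trace_le {ι : Type*} [DecidableEq ι] (m : ι → ι → ℝ) (T : Finset ι) (α : ℝ)
    (h : ∀ I J : Finset ι, |∑ i ∈ I, ∑ j ∈ J, m i j| ≤ α) : ∑ i ∈ T, m i i ≤ 4 * α := by
  obtain ⟨e, he, hle⟩ := sign_choice m T
  refine hle.trans ?_
  set I := T.filter (fun i => e i = 1)
  set J := T.filter (fun i => ¬ e i = 1)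
  have hI : ∀ i ∈ I, e i = 1 := fun i hi => (Finset.mem_filter.1 hi).2
  have hJ : ∀ i ∈ J, e i = -1 := fun i hi => (he i).resolve_left (Finset.mem_filter.1 hi).2
  have split : ∀ f : ι → ℝ, ∑ i ∈ T, e i * f i = ∑ i ∈ I, f i - ∑ i ∈ J, f i := by
    intro f
    rw [← Finset.sum_filter_add_sum_filter_not T (fun i => e i = 1)]
    have h1 : ∑ i ∈ I, e i * f i = ∑ i ∈ I, f i :=
      Finset.sum_congr rfl fun i hi => by rw [hI i hi, one_mul]
    have h2 : ∑ i ∈ J, e i * f i = - ∑ i ∈ J, f i := by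
      rw [← Finset.sum_neg_distrib]
      exact Finset.sum_congr rfl fun i hi => by rw [hJ i hi]; ring
    change ∑ i ∈ I, e i * f i + ∑ i ∈ J, e i * f i = _
    rw [h1, h2]; ring
  have h3 : ∑ i ∈ T, ∑ j ∈ T, e i * e j * m i j =
      (∑ i ∈ I, ∑ j ∈ I, m i j - ∑ i ∈ I, ∑ j ∈ J, m i j) -
      (∑ i ∈ J, ∑ j ∈ I, m i j - ∑ i ∈ J, ∑ j ∈ J, m i j) := by
    rw [← Finset.sum_sub_distrib, ← Finset.sum_sub_distrib]
    rw [← split]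
    refine Finset.sum_congr rfl fun i _ => ?_
    rw [← split, Finset.mul_sum]
    exact Finset.sum_congr rfl fun j _ => by ring
  rw [h3]
  have a1 := abs_le.1 (h I I)
  have a2 := abs_le.1 (h I J)
  have a3 := abs_le.1 (h J I)
  have a4 := abs_le.1 (h J J)
  linarith [a1.2, a2.1, a3.1, a4.2]

variable {Ω : Type*} [MeasurableSpace Ω]

lemma disj_sum {F ι : Type*} [MeasurableSpace F] [DecidableEq ι] (P : Measure Ω)
    [IsProbabilityMeasure P]
    (X Y : Ω → F) (hX : Measurable X) (hY : Measurable Y) (α : ℝ)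
    (hα : ∀ A B : Set F, MeasurableSet A → MeasurableSet B →
      |P.real (X ⁻¹' A) * P.real (Y ⁻¹' B) - P.real (X ⁻¹' A ∩ Y ⁻¹' B)| ≤ α)
    (A B : ι → Set F) (hA : ∀ i, MeasurableSet (A i)) (hB : ∀ i, MeasurableSet (B i))
    (dA : Pairwise (Function.onFun Disjoint A)) (dB : Pairwise (Function.onFun Disjoint B)) :
    ∑' i, P (X ⁻¹' A i ∩ Y ⁻¹' B i) ≤
      ∑' i, P (X ⁻¹' A i) * P (Y ⁻¹' B i) + ENNReal.ofReal (4 * α) := by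
  have hα0 : 0 ≤ α := (abs_nonneg _).trans (hα ∅ ∅ MeasurableSet.empty MeasurableSet.empty)
  rw [ENNReal.tsum_eq_iSup_sum]
  refine iSup_le fun T => ?_
  have hXd : ∀ I : Finset ι, (I : Set ι).PairwiseDisjoint (fun i => X ⁻¹' A i) := fun I i _ j _ hij =>
    (dA hij).preimage X
  have hYd : ∀ I : Finset ι, (I : Set ι).PairwiseDisjoint (fun i => Y ⁻¹' B i) := fun I i _ j _ hij =>
    (dB hij).preimage Y
  have key := trace_le (fun i j => P.real (X ⁻¹' A i ∩ Y ⁻¹' B j) -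
    P.real (X ⁻¹' A i) * P.real (Y ⁻¹' B j)) T α (by
      intro I J
      have hAI : MeasurableSet (⋃ i ∈ I, A i) := Finset.measurableSet_biUnion _ fun i _ => hA i
      have hBJ : MeasurableSet (⋃ i ∈ J, B i) := Finset.measurableSet_biUnion _ fun i _ => hB i
      have h := hα _ _ hAI hBJ
      rw [abs_sub_comm] at h
      refine le_trans (le_of_eq ?_) h
      congr 1
      rw [Set.preimage_iUnion₂, Set.preimage_iUnion₂]
      rw [measureReal_biUnion_finset (hXd I) (fun i _ => hX (hA i)),
        measureReal_biUnion_finset (hYd J) (fun i _ => hY (hB i)), Finset.sum_mul_sum]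
      simp only [Finset.sum_sub_distrib]
      congr 1
      rw [Set.iUnion₂_inter, measureReal_biUnion_finset]
      · refine Finset.sum_congr rfl fun i _ => ?_
        rw [Set.inter_iUnion₂, measureReal_biUnion_finset]
        · intro j hj k hk hjk
          exact (hYd J hj hk hjk).mono Set.inter_subset_right Set.inter_subset_right
        · exact fun j _ => (hX (hA i)).inter (hY (hB j))
      · intro j hj k hk hjk
        exact (hXd I hj hk hjk).mono Set.inter_subset_left Set.inter_subset_left
      · exact fun i _ => (hX (hA i)).inter
          (Finset.measurableSet_biUnion _ fun j _ => hY (hB j)))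
  rw [Finset.sum_sub_distrib] at key
  have h1 : ∑ i ∈ T, P (X ⁻¹' A i ∩ Y ⁻¹' B i) =
      ENNReal.ofReal (∑ i ∈ T, P.real (X ⁻¹' A i ∩ Y ⁻¹' B i)) := by
    rw [ENNReal.ofReal_sum_of_nonneg fun _ _ => measureReal_nonneg]
    exact Finset.sum_congr rfl fun i _ => (ofReal_measureReal).symm
  have h2 : ∑ i ∈ T, P (X ⁻¹' A i) * P (Y ⁻¹' B i) =
      ENNReal.ofReal (∑ i ∈ T, P.real (X ⁻¹' A i) * P.real (Y ⁻¹' B i)) := by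
    rw [ENNReal.ofReal_sum_of_nonneg fun _ _ => mul_nonneg measureReal_nonneg measureReal_nonneg]
    refine Finset.sum_congr rfl fun i _ => ?_
    rw [ENNReal.ofReal_mul measureReal_nonneg, ofReal_measureReal, ofReal_measureReal]
  calc _ = _ := h1
    _ ≤ ENNReal.ofReal (∑ i ∈ T, P.real (X ⁻¹' A i) * P.real (Y ⁻¹' B i) + 4 * α) :=
        ENNReal.ofReal_le_ofReal (by linarith)
    _ ≤ _ := ENNReal.ofReal_add_le
    _ ≤ _ := by
      rw [← h2]
      gcongr
      exact ENNReal.sum_le_tsum T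

/-- scaled standard basis -/
def sb (d : ℕ) (r : ℝ) (i : Fin d) : EuclideanSpace ℝ (Fin d) := r • EuclideanSpace.single i (1:ℝ)

lemma sb_comb (r : ℝ) (t : Fin d → ℝ) (i : Fin d) : (∑ i, t i • sb d r i) i = t i * r := by
  simp [sb, Finset.sum_apply, Pi.single_apply]

lemma sb_li (r : ℝ) (hr : 0 < r) : LinearIndependent ℝ (sb d r) := by
  rw [Fintype.linearIndependent_iff]
  intro g hg i
  have := sb_comb r g i
  rw [hg] at this
  simpa [hr.ne'] using this

lemma sb_vol (r : ℝ) (hr : 0 < r) : volume (DD (sb d r)) ≤ ENNReal.ofReal (r ^ d) * volume (DD (sb d 1)) := by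
  have h : DD (sb d r) ⊆ r • DD (sb d 1) := by
    rintro x ⟨t, ht, rfl⟩
    refine ⟨∑ i, t i • sb d 1 i, ⟨t, ht, rfl⟩, ?_⟩
    simp only [sb, Finset.smul_sum, one_smul]
    exact Finset.sum_congr rfl fun i _ => smul_comm _ _ _
  refine (measure_mono h).trans ?_
  rw [Measure.addHaar_smul, abs_of_nonneg (by positivity)]
  simp

lemma sb_sep (r : ℝ) (hr : 0 < r) (m n : Fin d → ℤ) (hmn : m ≠ n) :
    r ≤ ‖LL (sb d r) m - LL (sb d r) n‖ := by
  obtain ⟨i, hi⟩ := Function.ne_iff.1 hmn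
  have h1 := EuclideanSpace.norm_eq (LL (sb d r) m - LL (sb d r) n)
  have h2 : (LL (sb d r) m - LL (sb d r) n) i = (m i - n i : ℝ) * r := by
    rw [PiLp.sub_apply, LL, LL, sb_comb, sb_comb]; ring
  have h3 := PiLp.norm_apply_le (LL (sb d r) m - LL (sb d r) n) i
  rw [h2, norm_mul, Real.norm_eq_abs, Real.norm_eq_abs, abs_of_pos hr] at h3
  have h4 : (1:ℝ) ≤ |(m i - n i : ℝ)| := by
    have : 1 ≤ |m i - n i| := Int.one_le_abs (sub_ne_zero.2 hi)
    exact_mod_cast this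
  nlinarith

lemma ballpre_meas (r : ℝ) (z : EuclideanSpace ℝ (Fin d)) :
    MeasurableSet {x : EuclideanSpace ℝ (Fin d) | z + x ∈ Metric.closedBall 0 r} :=
  measurable_const_add z Metric.isClosed_closedBall.measurableSet

lemma ind_lint (P : Measure Ω) (X : Ω → EuclideanSpace ℝ (Fin d)) (hX : Measurable X) (r : ℝ)
    (z : EuclideanSpace ℝ (Fin d)) :
    ∫⁻ ω, ind r (z + X ω) ∂P = P (X ⁻¹' {x | z + x ∈ Metric.closedBall 0 r}) := by
  rw [← lintegral_indicator_one (hX (ballpre_meas r z))]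
  rfl

lemma ind_lint2 (P : Measure Ω) (X Y : Ω → EuclideanSpace ℝ (Fin d)) (hX : Measurable X)
    (hY : Measurable Y) (r : ℝ) (z w : EuclideanSpace ℝ (Fin d)) :
    ∫⁻ ω, ind r (z + X ω) * ind r (w + Y ω) ∂P =
      P (X ⁻¹' {x | z + x ∈ Metric.closedBall 0 r} ∩ Y ⁻¹' {x | w + x ∈ Metric.closedBall 0 r}) := by
  rw [← lintegral_indicator_one
    ((hX (ballpre_meas r z)).inter
    (hY (ballpre_meas r w)))]
  refine lintegral_congr fun ω => ?_
  rw [Set.inter_indicator_one]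
  rfl

lemma ball_disj (r : ℝ) (hr : 0 < r) (w : EuclideanSpace ℝ (Fin d)) :
    Pairwise (Function.onFun Disjoint fun m : Fin d → ℤ =>
      {x : EuclideanSpace ℝ (Fin d) | LL (sb d (3 * r)) m + w + x ∈ Metric.closedBall 0 r}) := by
  intro m n hmn
  rw [Function.onFun, Set.disjoint_left]
  intro x hx hy
  have hx' : ‖LL (sb d (3 * r)) m + w + x‖ ≤ r := by simpa using hx
  have hy' : ‖LL (sb d (3 * r)) n + w + x‖ ≤ r := by simpa using hy
  have h := sb_sep (3 * r) (by linarith) m n hmn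
  have h2 := norm_sub_le (LL (sb d (3 * r)) m + w + x) (LL (sb d (3 * r)) n + w + x)
  rw [show (LL (sb d (3 * r)) m + w + x) - (LL (sb d (3 * r)) n + w + x) =
    LL (sb d (3 * r)) m - LL (sb d (3 * r)) n by abel] at h2
  linarith

/-- covariance bound for the overlap -/
lemma mixing_bound (P : Measure Ω) [IsProbabilityMeasure P]
    (X Y : Ω → EuclideanSpace ℝ (Fin d)) (hX : Measurable X) (hY : Measurable Y) (α : ℝ)
    (hα : ∀ A B : Set (EuclideanSpace ℝ (Fin d)), MeasurableSet A → MeasurableSet B →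
      |P.real (X ⁻¹' A) * P.real (Y ⁻¹' B) - P.real (X ⁻¹' A ∩ Y ⁻¹' B)| ≤ α)
    (L : EuclideanSpace ℝ (Fin d)) (r : ℝ) (hr : 0 < r) :
    ∫⁻ ω, GG r (L + Y ω - X ω) ∂P ≤ ∫⁻ ω, ∫⁻ ω', GG r (L + Y ω' - X ω) ∂P ∂P +
      ENNReal.ofReal (4 * α) * (ENNReal.ofReal ((3 * r) ^ d) * volume (DD (sb d 1))) := by
  have hm := ind_meas (d := d) r
  have e1 : ∫⁻ ω, GG r (L + Y ω - X ω) ∂P =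
      ∫⁻ z, P (X ⁻¹' {x | z + x ∈ Metric.closedBall 0 r} ∩
        Y ⁻¹' {x | z + L + x ∈ Metric.closedBall 0 r}) := by
    simp_rw [← GG_shift]
    rw [lintegral_lintegral_swap]
    · refine lintegral_congr fun z => ?_
      rw [← ind_lint2 P X Y hX hY]
      simp_rw [add_assoc]
    · refine Measurable.aemeasurable ?_
      exact (hm.comp (measurable_snd.add (hX.comp measurable_fst))).mul
        (hm.comp (measurable_snd.add ((hY.comp measurable_fst).const_add L)))
  have e2 : ∫⁻ ω, ∫⁻ ω', GG r (L + Y ω' - X ω) ∂P ∂P =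
      ∫⁻ z, P (X ⁻¹' {x | z + x ∈ Metric.closedBall 0 r}) *
        P (Y ⁻¹' {x | z + L + x ∈ Metric.closedBall 0 r}) := by
    have : ∀ ω, ∫⁻ ω', GG r (L + Y ω' - X ω) ∂P = ∫⁻ z, ind r (z + X ω) *
        P (Y ⁻¹' {x | z + L + x ∈ Metric.closedBall 0 r}) := by
      intro ω
      simp_rw [← GG_shift]
      rw [lintegral_lintegral_swap]
      · refine lintegral_congr fun z => ?_
        rw [lintegral_const_mul, ← ind_lint P Y hY]
        · simp_rw [add_assoc]
        · exact hm.comp ((hY.const_add L).const_add z)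
      · refine Measurable.aemeasurable ?_
        exact (hm.comp (measurable_snd.add measurable_const)).mul
          (hm.comp (measurable_snd.add ((hY.comp measurable_fst).const_add L)))
    simp_rw [this]
    rw [lintegral_lintegral_swap]
    · refine lintegral_congr fun z => ?_
      rw [lintegral_mul_const, ind_lint P X hX]
      exact hm.comp (hX.const_add z)
    · refine Measurable.aemeasurable ?_
      refine (hm.comp (measurable_snd.add (hX.comp measurable_fst))).mul ?_
      have : Measurable fun z : EuclideanSpace ℝ (Fin d) =>
          P (Y ⁻¹' {x | z + L + x ∈ Metric.closedBall 0 r}) := by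
        simp_rw [← ind_lint P Y hY]
        exact Measurable.lintegral_prod_right' (f := fun q : _ × _ => ind r (q.1 + L + Y q.2))
          (hm.comp ((measurable_fst.add_const L).add (hY.comp measurable_snd)))
      exact this.comp measurable_snd
  rw [e1, e2]
  have h3 : 0 < 3 * r := by linarith
  have hli := sb_li (d := d) (3 * r) h3
  rw [tiling _ hli, tiling (sb d (3 * r)) hli (fun z =>
    P (X ⁻¹' {x | z + x ∈ Metric.closedBall 0 r}) *
        P (Y ⁻¹' {x | z + L + x ∈ Metric.closedBall 0 r}))]
  have mE : ∀ m, Measurable fun u => P (X ⁻¹' {x | LL (sb d (3 * r)) m + u + x ∈ Metric.closedBall 0 r} ∩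
        Y ⁻¹' {x | LL (sb d (3 * r)) m + u + L + x ∈ Metric.closedBall 0 r}) := by
    intro m
    simp_rw [← ind_lint2 P X Y hX hY]
    exact Measurable.lintegral_prod_right' (f := fun q : _ × _ =>
      ind r (LL (sb d (3 * r)) m + q.1 + X q.2) * ind r (LL (sb d (3 * r)) m + q.1 + L + Y q.2))
      ((hm.comp ((measurable_fst.const_add _).add (hX.comp measurable_snd))).mul
      (hm.comp (((measurable_fst.const_add _).add_const L).add (hY.comp measurable_snd))))
  have mF : ∀ m, Measurable fun u => P (X ⁻¹' {x | LL (sb d (3 * r)) m + u + x ∈ Metric.closedBall 0 r}) *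
        P (Y ⁻¹' {x | LL (sb d (3 * r)) m + u + L + x ∈ Metric.closedBall 0 r}) := by
    intro m
    simp_rw [← ind_lint P X hX, ← ind_lint P Y hY]
    exact (Measurable.lintegral_prod_right' (f := fun q : _ × _ =>
      ind r (LL (sb d (3 * r)) m + q.1 + X q.2))
      (hm.comp ((measurable_fst.const_add _).add (hX.comp measurable_snd)))).mul
      (Measurable.lintegral_prod_right' (f := fun q : _ × _ =>
      ind r (LL (sb d (3 * r)) m + q.1 + L + Y q.2))
      (hm.comp (((measurable_fst.const_add _).add_const L).add (hY.comp measurable_snd))))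
  rw [← lintegral_tsum fun m => (mE m).aemeasurable, ← lintegral_tsum fun m => (mF m).aemeasurable]
  calc _ ≤ ∫⁻ u in DD (sb d (3 * r)), ((∑' m,
        P (X ⁻¹' {x | LL (sb d (3 * r)) m + u + x ∈ Metric.closedBall 0 r}) *
        P (Y ⁻¹' {x | LL (sb d (3 * r)) m + u + L + x ∈ Metric.closedBall 0 r})) +
        ENNReal.ofReal (4 * α)) := by
        refine lintegral_mono fun u => ?_
        refine disj_sum P X Y hX hY α hα _ _ (fun m => ?_) (fun m => ?_) (ball_disj r hr u) ?_
        · exact measurable_const_add _ Metric.isClosed_closedBall.measurableSet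
        · exact measurable_const_add _ Metric.isClosed_closedBall.measurableSet
        · have := ball_disj (d := d) r hr (u + L)
          simpa only [← add_assoc] using this
    _ = _ + ENNReal.ofReal (4 * α) * volume (DD (sb d (3 * r))) := by
        rw [lintegral_add_right _ measurable_const, setLIntegral_const]
    _ ≤ _ := by
        gcongr
        exact sb_vol _ h3

end HU

namespace HU
open scoped ENNReal

variable {d : ℕ}

def VV (d : ℕ) (r : ℝ) : ℝ≥0∞ := volume (Metric.closedBall (0 : EuclideanSpace ℝ (Fin d)) r)

lemma VV_eq (r : ℝ) (hr : 0 ≤ r) : VV d r = ENNReal.ofReal (r ^ d) * VV d 1 := by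
  unfold VV
  rw [Measure.addHaar_closedBall' _ _ hr]
  simp

lemma VV_one_pos : VV d 1 ≠ 0 := (Metric.measure_closedBall_pos _ _ one_pos).ne'

lemma VV_ne_top (r : ℝ) : VV d r ≠ ∞ := measure_closedBall_lt_top.ne

lemma VV_ne_zero (r : ℝ) (hr : 0 < r) : VV d r ≠ 0 := (Metric.measure_closedBall_pos _ _ hr).ne'

lemma GG_ge (r : ℝ) (y : EuclideanSpace ℝ (Fin d)) : VV d (r - ‖y‖) ≤ GG r y := by
  unfold GG VV
  rw [← lintegral_indicator_one Metric.isClosed_closedBall.measurableSet]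
  refine lintegral_mono fun z => ?_
  by_cases hz : z ∈ Metric.closedBall (0 : EuclideanSpace ℝ (Fin d)) (r - ‖y‖)
  · rw [Set.indicator_of_mem hz]
    have hz' : ‖z‖ ≤ r - ‖y‖ := by simpa using hz
    have h1 : z ∈ Metric.closedBall (0 : EuclideanSpace ℝ (Fin d)) r := by
      rw [mem_closedBall_zero_iff]; linarith [norm_nonneg y]
    have h2 : z + y ∈ Metric.closedBall (0 : EuclideanSpace ℝ (Fin d)) r := by
      rw [mem_closedBall_zero_iff]; linarith [norm_add_le z y]
    simp only [ind]
    rw [Set.indicator_of_mem h1, Set.indicator_of_mem h2]; simp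
  · rw [Set.indicator_of_notMem hz]; exact zero_le

lemma GG_lim (y : EuclideanSpace ℝ (Fin d)) :
    Tendsto (fun r => GG r y / VV d r) atTop (nhds 1) := by
  have hlow : Tendsto (fun r : ℝ => ENNReal.ofReal ((1 - ‖y‖ / r) ^ d)) atTop (nhds 1) := by
    have h1 : Tendsto (fun r : ℝ => (1 - ‖y‖ / r) ^ d) atTop (nhds ((1 - 0) ^ d)) :=
      (tendsto_const_nhds.sub (tendsto_const_nhds.div_atTop tendsto_id)).pow d
    have h2 := ENNReal.tendsto_ofReal h1
    simpa using h2
  refine tendsto_of_tendsto_of_tendsto_of_le_of_le' hlow tendsto_const_nhds ?_ ?_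
  · filter_upwards [eventually_gt_atTop ‖y‖, eventually_gt_atTop 0] with r hr hr0
    rw [ENNReal.le_div_iff_mul_le (Or.inl (VV_ne_zero r hr0)) (Or.inl (VV_ne_top r))]
    refine le_trans (le_of_eq ?_) (GG_ge r y)
    rw [VV_eq r hr0.le, VV_eq (r - ‖y‖) (by linarith), ← mul_assoc, ← ENNReal.ofReal_mul, ← mul_pow]
    · congr 3
      field_simp
    · have : ‖y‖ / r ≤ 1 := by rw [div_le_one hr0]; exact hr.le
      exact pow_nonneg (by linarith) _
  · filter_upwards with r
    exact ENNReal.div_le_of_le_mul (by rw [one_mul]; exact GG_le r y)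

lemma GG_int_lim {Ω : Type*} [MeasurableSpace Ω] (P : Measure Ω) [IsProbabilityMeasure P]
    (W : Ω → EuclideanSpace ℝ (Fin d)) (hW : Measurable W) :
    Tendsto (fun r => (∫⁻ ω, GG r (W ω) ∂P) / VV d r) atTop (nhds 1) := by
  have h := tendsto_lintegral_filter_of_dominated_convergence (μ := P) (l := (atTop : Filter ℝ))
    (F := fun r ω => GG r (W ω) / VV d r) (f := fun _ => 1) (fun _ => 1)
    (Eventually.of_forall fun r => ((GG_meas r).comp hW).div_const _)
    (Eventually.of_forall fun r => ae_of_all _ fun ω =>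
      ENNReal.div_le_of_le_mul (by rw [one_mul]; exact GG_le r _)) (by simp)
    (ae_of_all _ fun ω => GG_lim (W ω))
  simp only [lintegral_const, measure_univ, mul_one] at h
  refine h.congr fun r => ?_
  simp_rw [div_eq_mul_inv]
  exact lintegral_mul_const _ ((GG_meas r).comp hW)

section Mix

variable {Ω : Type*} [mΩ : MeasurableSpace Ω] (P : Measure Ω) [IsProbabilityMeasure P]

lemma prob_toReal_le (A : Set Ω) : (P A).toReal ≤ 1 := measureReal_le_one

lemma alpha_elem_le (A B : Set Ω) :
    |(P A).toReal * (P B).toReal - (P (A ∩ B)).toReal| ≤ 1 := by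
  have h1 : (P A).toReal ≤ 1 := prob_toReal_le P A
  have h2 : (P B).toReal ≤ 1 := prob_toReal_le P B
  have h3 : (P (A ∩ B)).toReal ≤ 1 := prob_toReal_le P _
  have g1 : 0 ≤ (P A).toReal := ENNReal.toReal_nonneg
  have g2 : 0 ≤ (P B).toReal := ENNReal.toReal_nonneg
  have g3 : 0 ≤ (P (A ∩ B)).toReal := ENNReal.toReal_nonneg
  rw [abs_le]
  constructor <;> nlinarith [mul_nonneg g1 g2]

lemma alphaSigma_nonneg (m₁ m₂ : MeasurableSpace Ω) : 0 ≤ @alphaSigma Ω mΩ P m₁ m₂ := by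
  apply Real.sSup_nonneg
  rintro x ⟨A, B, _, _, rfl⟩
  exact abs_nonneg _

lemma alphaSigma_le (m₁ m₂ : MeasurableSpace Ω) : @alphaSigma Ω mΩ P m₁ m₂ ≤ 1 := by
  refine Real.sSup_le ?_ zero_le_one
  rintro x ⟨A, B, _, _, rfl⟩
  exact @alpha_elem_le Ω mΩ P ‹_› A B

lemma le_alphaSigma (m₁ m₂ : MeasurableSpace Ω) (A B : Set Ω) (hA : MeasurableSet[m₁] A)
    (hB : MeasurableSet[m₂] B) :
    |(P A).toReal * (P B).toReal - (P (A ∩ B)).toReal| ≤ @alphaSigma Ω mΩ P m₁ m₂ := by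
  refine le_csSup ⟨1, ?_⟩ ⟨A, B, hA, hB, rfl⟩
  rintro x ⟨A, B, _, _, rfl⟩
  exact @alpha_elem_le Ω mΩ P ‹_› A B

variable {ι F : Type*} [MeasurableSpace F] (pos : ι → EuclideanSpace ℝ (Fin d)) (p : ι → Ω → F)

lemma mixCoef_nonneg (n : ℝ) : 0 ≤ mixCoef P pos p n := by
  apply Real.sSup_nonneg
  rintro x ⟨A, B, _, rfl⟩
  exact alphaSigma_nonneg _ _ _

lemma mixCoef_le (n : ℝ) : mixCoef P pos p n ≤ 1 := by
  refine Real.sSup_le ?_ zero_le_one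
  rintro x ⟨A, B, _, rfl⟩
  exact alphaSigma_le _ _ _

lemma le_mixCoef (n : ℝ) (i j : ι) (hij : n ≤ ‖pos i - pos j‖) (A B : Set F)
    (hA : MeasurableSet A) (hB : MeasurableSet B) :
    |P.real (p i ⁻¹' A) * P.real (p j ⁻¹' B) - P.real (p i ⁻¹' A ∩ p j ⁻¹' B)| ≤
      mixCoef P pos p n := by
  have h1 := le_alphaSigma P (sigmaGen p (({i} : Finset ι) : Set ι))
    (sigmaGen p (({j} : Finset ι) : Set ι)) (p i ⁻¹' A) (p j ⁻¹' B)
    (by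
      have : MeasurableSpace.comap (p i) inferInstance ≤ sigmaGen p (({i} : Finset ι) : Set ι) :=
        le_iSup₂_of_le i (by simp) le_rfl
      exact this _ ⟨A, hA, rfl⟩)
    (by
      have : MeasurableSpace.comap (p j) inferInstance ≤ sigmaGen p (({j} : Finset ι) : Set ι) :=
        le_iSup₂_of_le j (by simp) le_rfl
      exact this _ ⟨B, hB, rfl⟩)
  refine h1.trans (le_csSup ⟨1, ?_⟩ ⟨{i}, {j}, ?_, rfl⟩)
  · rintro x ⟨A, B, _, rfl⟩
    exact alphaSigma_le _ _ _
  · intro i' hi' j' hj'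
    rw [Finset.mem_singleton] at hi' hj'
    rw [hi', hj']; exact hij

end Mix

lemma pair_law
    {Ω : Type*} [MeasurableSpace Ω] (P : Measure Ω) [IsProbabilityMeasure P]
    (p : (Fin d → ℤ) → Ω → EuclideanSpace ℝ (Fin d))
    (hpm : ∀ m, Measurable (p m))
    (hstat : ∀ (j : Fin d → ℤ) (Λ : Finset (Fin d → ℤ)),
      Measure.map (fun ω => fun m : Λ => p (↑m + j) ω) P =
      Measure.map (fun ω => fun m : Λ => p ↑m ω) P)
    (m k : Fin d → ℤ)
    (f : EuclideanSpace ℝ (Fin d) × EuclideanSpace ℝ (Fin d) → ℝ≥0∞) (hf : Measurable f) :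
    ∫⁻ ω, f (p m ω, p (k + m) ω) ∂P = ∫⁻ ω, f (p 0 ω, p k ω) ∂P := by
  have h := hstat m {0, k}
  let z0 : (({0, k} : Finset (Fin d → ℤ))) := ⟨0, by simp⟩
  let zk : (({0, k} : Finset (Fin d → ℤ))) := ⟨k, by simp⟩
  have hg : Measurable fun g : (({0, k} : Finset (Fin d → ℤ))) → EuclideanSpace ℝ (Fin d) =>
      f (g z0, g zk) := hf.comp ((measurable_pi_apply z0).prodMk (measurable_pi_apply zk))
  have h2 := congrArg (fun μ => ∫⁻ g, f (g z0, g zk) ∂μ) h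
  rw [lintegral_map hg (measurable_pi_lambda _ fun i => hpm _),
    lintegral_map hg (measurable_pi_lambda _ fun i => hpm _)] at h2
  simpa [z0, zk] using h2

lemma triple_law
    {Ω : Type*} [MeasurableSpace Ω] (P : Measure Ω) [IsProbabilityMeasure P]
    (p : (Fin d → ℤ) → Ω → EuclideanSpace ℝ (Fin d))
    (hpm : ∀ m, Measurable (p m))
    (hstat : ∀ (j : Fin d → ℤ) (Λ : Finset (Fin d → ℤ)),
      Measure.map (fun ω => fun m : Λ => p (↑m + j) ω) P =
      Measure.map (fun ω => fun m : Λ => p ↑m ω) P)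
    (D : Set (EuclideanSpace ℝ (Fin d)))
    (U : Ω → EuclideanSpace ℝ (Fin d))
    (hUmeas : Measurable U)
    (hU : Measure.map U P = (volume D)⁻¹ • volume.restrict D)
    (hindep : IndepFun U (fun ω => fun m : Fin d → ℤ => p m ω) P)
    (m k : Fin d → ℤ)
    (f : EuclideanSpace ℝ (Fin d) × (EuclideanSpace ℝ (Fin d) × EuclideanSpace ℝ (Fin d)) → ℝ≥0∞)
    (hf : Measurable f) :
    ∫⁻ ω, f (U ω, (p m ω, p (k + m) ω)) ∂P =
      (volume D)⁻¹ * ∫⁻ ω, (∫⁻ u in D, f (u, (p 0 ω, p k ω))) ∂P := by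
  have hpair : Measurable fun ω => (p m ω, p (k + m) ω) := (hpm _).prodMk (hpm _)
  have hi : IndepFun U (fun ω => (p m ω, p (k + m) ω)) P :=
    hindep.comp (φ := id) (ψ := fun g : (Fin d → ℤ) → EuclideanSpace ℝ (Fin d) => (g m, g (k + m)))
      measurable_id ((measurable_pi_apply _).prodMk (measurable_pi_apply _))
  have h1 := (indepFun_iff_map_prod_eq_prod_map_map hUmeas.aemeasurable hpair.aemeasurable).1 hi
  have hf2 : Measurable fun q : EuclideanSpace ℝ (Fin d) × EuclideanSpace ℝ (Fin d) =>
      ∫⁻ u in D, f (u, q) := hf.lintegral_prod_left'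
  calc ∫⁻ ω, f (U ω, (p m ω, p (k + m) ω)) ∂P
      = ∫⁻ q, f q ∂(Measure.map (fun ω => (U ω, (p m ω, p (k + m) ω))) P) := by
        rw [lintegral_map hf (hUmeas.prodMk hpair)]
    _ = ∫⁻ q, (∫⁻ u, f (u, q) ∂(Measure.map U P)) ∂(Measure.map (fun ω => (p m ω, p (k + m) ω)) P) := by
        have : IsProbabilityMeasure (Measure.map U P) :=
          Measure.isProbabilityMeasure_map hUmeas.aemeasurable
        have : IsProbabilityMeasure (Measure.map (fun ω => (p m ω, p (k + m) ω)) P) :=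
          Measure.isProbabilityMeasure_map hpair.aemeasurable
        rw [h1, lintegral_prod_symm _ hf.aemeasurable]
    _ = ∫⁻ q, (volume D)⁻¹ * (∫⁻ u in D, f (u, q)) ∂(Measure.map (fun ω => (p m ω, p (k + m) ω)) P) := by
        rw [hU]
        simp only [lintegral_smul_measure, smul_eq_mul]
    _ = (volume D)⁻¹ * ∫⁻ ω, (∫⁻ u in D, f (u, (p m ω, p (k + m) ω))) ∂P := by
        rw [lintegral_map (hf2.const_mul _) hpair]
        exact lintegral_const_mul _ (hf2.comp hpair)
    _ = _ := by rw [pair_law P p hpm hstat m k _ hf2]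


end HU

namespace HU
open scoped ENNReal

variable {d : ℕ}

/-- extended count -/
def NN {Ω : Type*} (a : Fin d → EuclideanSpace ℝ (Fin d))
    (p : (Fin d → ℤ) → Ω → EuclideanSpace ℝ (Fin d)) (U : Ω → EuclideanSpace ℝ (Fin d))
    (r : ℝ) (ω : Ω) : ℝ≥0∞ := ∑' m, ind r (LL a m + p m ω + U ω)

lemma NN_meas {Ω : Type*} [MeasurableSpace Ω] (a : Fin d → EuclideanSpace ℝ (Fin d))
    (p : (Fin d → ℤ) → Ω → EuclideanSpace ℝ (Fin d)) (U : Ω → EuclideanSpace ℝ (Fin d))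
    (hpm : ∀ m, Measurable (p m)) (hUmeas : Measurable U) (r : ℝ) :
    Measurable (NN a p U r) := by
  unfold NN
  exact Measurable.tsum fun m => (ind_meas r).comp (((hpm m).const_add _).add hUmeas)

lemma first_moment
    {Ω : Type*} [MeasurableSpace Ω] (P : Measure Ω) [IsProbabilityMeasure P]
    (a : Fin d → EuclideanSpace ℝ (Fin d)) (ha : LinearIndependent ℝ a)
    (p : (Fin d → ℤ) → Ω → EuclideanSpace ℝ (Fin d))
    (hpm : ∀ m, Measurable (p m))
    (hstat : ∀ (j : Fin d → ℤ) (Λ : Finset (Fin d → ℤ)),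
      Measure.map (fun ω => fun m : Λ => p (↑m + j) ω) P =
      Measure.map (fun ω => fun m : Λ => p ↑m ω) P)
    (U : Ω → EuclideanSpace ℝ (Fin d))
    (hUmeas : Measurable U)
    (hU : Measure.map U P = (volume (DD a))⁻¹ • volume.restrict (DD a))
    (hindep : IndepFun U (fun ω => fun m : Fin d → ℤ => p m ω) P)
    (r : ℝ) : ∫⁻ ω, NN a p U r ω ∂P = (volume (DD a))⁻¹ * VV d r := by
  have hm := ind_meas (d := d) r
  have hmm : ∀ m, Measurable fun ω => ind r (LL a m + p m ω + U ω) := fun m =>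
    hm.comp (((hpm m).const_add _).add hUmeas)
  unfold NN
  rw [lintegral_tsum fun m => (hmm m).aemeasurable]
  have h1 : ∀ m, ∫⁻ ω, ind r (LL a m + p m ω + U ω) ∂P =
      (volume (DD a))⁻¹ * ∫⁻ ω, (∫⁻ u in DD a, ind r (LL a m + u + p 0 ω)) ∂P := by
    intro m
    have := triple_law P p hpm hstat (DD a) U hUmeas hU hindep m 0
      (fun q => ind r (LL a m + q.1 + q.2.1))
      (hm.comp ((measurable_fst.const_add _).add (measurable_fst.comp measurable_snd)))
    simp only at this
    rw [← this]
    refine lintegral_congr fun ω => ?_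
    congr 1; abel
  simp_rw [h1]
  rw [ENNReal.tsum_mul_left, ← lintegral_tsum]
  · congr 1
    have h2 : ∀ ω, ∑' m, ∫⁻ u in DD a, ind r (LL a m + u + p 0 ω) = VV d r := by
      intro ω
      rw [← tiling a ha (fun z => ind r (z + p 0 ω)), lintegral_add_right_eq_self (ind r)]
      exact lintegral_indicator_one Metric.isClosed_closedBall.measurableSet
    simp_rw [h2]
    simp
  · intro m
    exact (Measurable.lintegral_prod_right' (f := fun q : Ω × _ => ind r (LL a m + q.2 + p 0 q.1))
      (hm.comp ((measurable_snd.const_add _).add ((hpm 0).comp measurable_fst)))).aemeasurable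

lemma second_moment
    {Ω : Type*} [MeasurableSpace Ω] (P : Measure Ω) [IsProbabilityMeasure P]
    (a : Fin d → EuclideanSpace ℝ (Fin d)) (ha : LinearIndependent ℝ a)
    (p : (Fin d → ℤ) → Ω → EuclideanSpace ℝ (Fin d))
    (hpm : ∀ m, Measurable (p m))
    (hstat : ∀ (j : Fin d → ℤ) (Λ : Finset (Fin d → ℤ)),
      Measure.map (fun ω => fun m : Λ => p (↑m + j) ω) P =
      Measure.map (fun ω => fun m : Λ => p ↑m ω) P)
    (U : Ω → EuclideanSpace ℝ (Fin d))
    (hUmeas : Measurable U)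
    (hU : Measure.map U P = (volume (DD a))⁻¹ • volume.restrict (DD a))
    (hindep : IndepFun U (fun ω => fun m : Fin d → ℤ => p m ω) P)
    (r : ℝ) : ∫⁻ ω, NN a p U r ω ^ 2 ∂P =
      (volume (DD a))⁻¹ * ∑' k, ∫⁻ ω, GG r (LL a k + p k ω - p 0 ω) ∂P := by
  have hm := ind_meas (d := d) r
  have hmm : ∀ m, Measurable fun ω => ind r (LL a m + p m ω + U ω) := fun m =>
    hm.comp (((hpm m).const_add _).add hUmeas)
  have e0 : ∀ ω, NN a p U r ω ^ 2 = ∑' k, ∑' m, ind r (LL a m + p m ω + U ω) *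
      ind r (LL a (k + m) + p (k + m) ω + U ω) := by
    intro ω
    rw [ENNReal.tsum_comm, sq]
    conv_lhs => rw [NN, ← ENNReal.tsum_mul_right]
    refine tsum_congr fun m => ?_
    rw [← ENNReal.tsum_mul_left, ← (Equiv.addRight m).tsum_eq
      (fun n => ind r (LL a m + p m ω + U ω) * ind r (LL a n + p n ω + U ω))]
    rfl
  simp_rw [e0]
  have hm2 : ∀ k m, Measurable fun ω => ind r (LL a m + p m ω + U ω) *
      ind r (LL a (k + m) + p (k + m) ω + U ω) := fun k m => (hmm m).mul (hmm (k + m))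
  have hm3 : ∀ k, Measurable fun ω => ∑' m, ind r (LL a m + p m ω + U ω) *
      ind r (LL a (k + m) + p (k + m) ω + U ω) := fun k => Measurable.tsum fun m => hm2 k m
  rw [lintegral_tsum fun k => (hm3 k).aemeasurable,
    ← ENNReal.tsum_mul_left]
  refine tsum_congr fun k => ?_
  rw [lintegral_tsum fun m => (hm2 k m).aemeasurable]
  have h1 : ∀ m, ∫⁻ ω, ind r (LL a m + p m ω + U ω) *
      ind r (LL a (k + m) + p (k + m) ω + U ω) ∂P =
      (volume (DD a))⁻¹ * ∫⁻ ω, (∫⁻ u in DD a, ind r (LL a m + u + p 0 ω) *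
        ind r (LL a m + u + (LL a k + p k ω))) ∂P := by
    intro m
    have := triple_law P p hpm hstat (DD a) U hUmeas hU hindep m k
      (fun q => ind r (LL a m + q.1 + q.2.1) * ind r (LL a m + q.1 + (LL a k + q.2.2)))
      ((hm.comp ((measurable_fst.const_add _).add (measurable_fst.comp measurable_snd))).mul
      (hm.comp ((measurable_fst.const_add _).add
        ((measurable_snd.comp measurable_snd).const_add _))))
    simp only at this
    rw [← this]
    refine lintegral_congr fun ω => ?_
    congr 2
    · abel
    · rw [LL_add]; abel
  simp_rw [h1]
  rw [ENNReal.tsum_mul_left, ← lintegral_tsum]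
  · congr 1
    refine lintegral_congr fun ω => ?_
    rw [← tiling a ha (fun z => ind r (z + p 0 ω) * ind r (z + (LL a k + p k ω))), GG_shift]
  · intro m
    have q1 : Measurable fun q : Ω × EuclideanSpace ℝ (Fin d) => LL a m + q.2 + p 0 q.1 :=
      (measurable_snd.const_add _).add ((hpm 0).comp measurable_fst)
    have q2 : Measurable fun q : Ω × EuclideanSpace ℝ (Fin d) => LL a k + p k q.1 :=
      ((hpm k).comp measurable_fst).const_add _
    have q3 : Measurable fun q : Ω × EuclideanSpace ℝ (Fin d) => LL a m + q.2 + (LL a k + p k q.1) :=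
      (measurable_snd.const_add _).add q2
    have q4 : Measurable fun q : Ω × EuclideanSpace ℝ (Fin d) => ind r (LL a m + q.2 + p 0 q.1) *
        ind r (LL a m + q.2 + (LL a k + p k q.1)) := (hm.comp q1).mul (hm.comp q3)
    exact q4.lintegral_prod_right'.aemeasurable

end HU

namespace HU
open scoped ENNReal

variable {d : ℕ}

/-- overlap moment with dependence -/
def xx {Ω : Type*} [MeasurableSpace Ω] (P : Measure Ω) (a : Fin d → EuclideanSpace ℝ (Fin d))
    (p : (Fin d → ℤ) → Ω → EuclideanSpace ℝ (Fin d)) (r : ℝ) (k : Fin d → ℤ) : ℝ≥0∞ :=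
  ∫⁻ ω, GG r (LL a k + p k ω - p 0 ω) ∂P

/-- overlap moment for independent copies -/
def yy {Ω : Type*} [MeasurableSpace Ω] (P : Measure Ω) (a : Fin d → EuclideanSpace ℝ (Fin d))
    (p : (Fin d → ℤ) → Ω → EuclideanSpace ℝ (Fin d)) (r : ℝ) (k : Fin d → ℤ) : ℝ≥0∞ :=
  ∫⁻ ω, (∫⁻ ω', GG r (LL a k + p k ω' - p 0 ω) ∂P) ∂P

lemma yy_sum {Ω : Type*} [MeasurableSpace Ω] (P : Measure Ω) [IsProbabilityMeasure P]
    (a : Fin d → EuclideanSpace ℝ (Fin d)) (ha : LinearIndependent ℝ a)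
    (p : (Fin d → ℤ) → Ω → EuclideanSpace ℝ (Fin d))
    (hpm : ∀ m, Measurable (p m))
    (hstat : ∀ (j : Fin d → ℤ) (Λ : Finset (Fin d → ℤ)),
      Measure.map (fun ω => fun m : Λ => p (↑m + j) ω) P =
      Measure.map (fun ω => fun m : Λ => p ↑m ω) P) (r : ℝ) :
    ∑' k, yy P a p r k ≤ ∑' k, GG r (LL a k) := by
  have hG := GG_meas (d := d) r
  have h1 : ∀ k, yy P a p r k =
      ∫⁻ ω, (∫⁻ ω', GG r (LL a k + (p 0 ω' - p 0 ω)) ∂P) ∂P := by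
    intro k
    refine lintegral_congr fun ω => ?_
    have := pair_law P p hpm hstat k 0 (fun q => GG r (LL a k + (q.1 - p 0 ω)))
      (hG.comp ((measurable_fst.sub_const _).const_add _))
    simp only at this
    rw [← this]
    simp_rw [add_sub_assoc]
  have m1 : ∀ k, Measurable fun q : Ω × Ω => GG r (LL a k + (p 0 q.2 - p 0 q.1)) := fun k =>
    hG.comp ((((hpm 0).comp measurable_snd).sub ((hpm 0).comp measurable_fst)).const_add _)
  have m2 : ∀ k ω, Measurable fun ω' => GG r (LL a k + (p 0 ω' - p 0 ω)) := fun k ω =>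
    hG.comp (((hpm 0).sub_const _).const_add _)
  simp_rw [h1]
  rw [← lintegral_tsum fun k => (m1 k).lintegral_prod_right'.aemeasurable]
  calc _ ≤ ∫⁻ ω, (∑' k, GG r (LL a k)) ∂P := by
        refine lintegral_mono fun ω => ?_
        simp only
        rw [← lintegral_tsum fun k => (m2 k ω).aemeasurable]
        calc _ ≤ ∫⁻ ω', (∑' k, GG r (LL a k)) ∂P :=
              lintegral_mono fun ω' => sum_GG_shift_le a ha r _
          _ = _ := by simp
    _ = _ := by simp

lemma yy_lim {Ω : Type*} [MeasurableSpace Ω] (P : Measure Ω) [IsProbabilityMeasure P]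
    (a : Fin d → EuclideanSpace ℝ (Fin d))
    (p : (Fin d → ℤ) → Ω → EuclideanSpace ℝ (Fin d))
    (hpm : ∀ m, Measurable (p m)) (k : Fin d → ℤ) :
    Tendsto (fun r => yy P a p r k / VV d r) atTop (nhds 1) := by
  have hW : Measurable fun q : Ω × Ω => LL a k + p k q.2 - p 0 q.1 :=
    (((hpm k).comp measurable_snd).const_add _).sub ((hpm 0).comp measurable_fst)
  refine (GG_int_lim (P.prod P) _ hW).congr fun r => ?_
  have hm : Measurable fun q : Ω × Ω => GG r (LL a k + p k q.2 - p 0 q.1) :=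
    (GG_meas r).comp hW
  rw [yy, lintegral_prod _ hm.aemeasurable]

lemma diff_lim {Ω : Type*} [MeasurableSpace Ω] (P : Measure Ω) [IsProbabilityMeasure P]
    (a : Fin d → EuclideanSpace ℝ (Fin d))
    (p : (Fin d → ℤ) → Ω → EuclideanSpace ℝ (Fin d))
    (hpm : ∀ m, Measurable (p m)) (k : Fin d → ℤ) :
    Tendsto (fun r => (xx P a p r k - yy P a p r k) / VV d r) atTop (nhds 0) := by
  have h := ENNReal.Tendsto.sub (tendsto_const_nhds (x := (1:ℝ≥0∞)) (f := (atTop : Filter ℝ)))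
    (yy_lim P a p hpm k) (Or.inl ENNReal.one_ne_top)
  rw [tsub_self] at h
  refine tendsto_of_tendsto_of_tendsto_of_le_of_le' tendsto_const_nhds h
    (Eventually.of_forall fun r => zero_le) ?_
  filter_upwards [eventually_gt_atTop 0] with r hr
  have hx : xx P a p r k ≤ VV d r := by
    calc xx P a p r k ≤ ∫⁻ ω, VV d r ∂P := lintegral_mono fun ω => GG_le r _
      _ = _ := by simp
  rw [ENNReal.div_le_iff (VV_ne_zero r hr) (VV_ne_top r), ENNReal.sub_mul (fun _ _ => VV_ne_top r),
    one_mul, ENNReal.div_mul_cancel (VV_ne_zero r hr) (VV_ne_top r)]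
  exact tsub_le_tsub_right hx _

lemma diff_bound {Ω : Type*} [MeasurableSpace Ω] (P : Measure Ω) [IsProbabilityMeasure P]
    (a : Fin d → EuclideanSpace ℝ (Fin d))
    (p : (Fin d → ℤ) → Ω → EuclideanSpace ℝ (Fin d))
    (hpm : ∀ m, Measurable (p m)) (k : Fin d → ℤ) (r : ℝ) (hr : 0 < r) :
    (xx P a p r k - yy P a p r k) / VV d r ≤
      ENNReal.ofReal (mixCoef P (LL a) p ‖LL a k‖) *
        (ENNReal.ofReal 4 * (ENNReal.ofReal (3 ^ d) * volume (DD (sb d 1)) / VV d 1)) := by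
  have h := mixing_bound P (p 0) (p k) (hpm 0) (hpm k) (mixCoef P (LL a) p ‖LL a k‖)
    (fun A B hA hB => le_mixCoef P (LL a) p _ 0 k (by rw [LL_zero, zero_sub, norm_neg]) A B hA hB)
    (LL a k) r hr
  change xx P a p r k ≤ yy P a p r k + _ at h
  rw [ENNReal.div_le_iff (VV_ne_zero r hr) (VV_ne_top r), tsub_le_iff_left]
  refine h.trans (le_of_eq ?_)
  congr 1
  rw [VV_eq r hr.le, mul_pow, ENNReal.ofReal_mul (by positivity), ENNReal.ofReal_mul (by positivity),
    div_eq_mul_inv]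
  have hc : (VV d 1)⁻¹ * VV d 1 = 1 := ENNReal.inv_mul_cancel VV_one_pos (VV_ne_top 1)
  calc _ = ENNReal.ofReal (mixCoef P (LL a) p ‖LL a k‖) *
      (ENNReal.ofReal 4 * (ENNReal.ofReal (3 ^ d) * volume (DD (sb d 1)) * ((VV d 1)⁻¹ * VV d 1))) *
      ENNReal.ofReal (r ^ d) := by rw [hc]; ring
    _ = _ := by ring

lemma delta_lim {Ω : Type*} [MeasurableSpace Ω] (P : Measure Ω) [IsProbabilityMeasure P]
    (a : Fin d → EuclideanSpace ℝ (Fin d))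
    (p : (Fin d → ℤ) → Ω → EuclideanSpace ℝ (Fin d))
    (hpm : ∀ m, Measurable (p m))
    (hsum : Summable fun k => mixCoef P (LL a) p ‖LL a k‖) :
    Tendsto (fun r => ∑' k, (xx P a p r k - yy P a p r k) / VV d r) atTop (nhds 0) := by
  have h := tendsto_lintegral_filter_of_dominated_convergence
    (μ := (Measure.count : Measure (Fin d → ℤ))) (l := (atTop : Filter ℝ))
    (F := fun r k => (xx P a p r k - yy P a p r k) / VV d r) (f := fun _ => 0)
    (fun k => ENNReal.ofReal (mixCoef P (LL a) p ‖LL a k‖) *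
        (ENNReal.ofReal 4 * (ENNReal.ofReal (3 ^ d) * volume (DD (sb d 1)) / VV d 1)))
    (Eventually.of_forall fun r => measurable_of_countable _)
    (by
      filter_upwards [eventually_gt_atTop 0] with r hr
      exact ae_of_all _ fun k => diff_bound P a p hpm k r hr)
    (by
      rw [lintegral_count, ENNReal.tsum_mul_right]
      refine ENNReal.mul_ne_top ?_ ?_
      · rw [← ENNReal.ofReal_tsum_of_nonneg (fun k => mixCoef_nonneg P _ _ _) hsum]
        exact ENNReal.ofReal_ne_top
      · refine ENNReal.mul_ne_top ENNReal.ofReal_ne_top (ENNReal.div_ne_top (ENNReal.mul_ne_top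
          ENNReal.ofReal_ne_top ?_) VV_one_pos)
        exact DD_ne_top _ (sb_li 1 one_pos))
    (ae_of_all _ fun k => diff_lim P a p hpm k)
  simpa only [lintegral_count, tsum_zero] using h

lemma var_bound
    {Ω : Type*} [MeasurableSpace Ω] (P : Measure Ω) [IsProbabilityMeasure P]
    (a : Fin d → EuclideanSpace ℝ (Fin d)) (ha : LinearIndependent ℝ a)
    (p : (Fin d → ℤ) → Ω → EuclideanSpace ℝ (Fin d))
    (hpm : ∀ m, Measurable (p m))
    (hstat : ∀ (j : Fin d → ℤ) (Λ : Finset (Fin d → ℤ)),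
      Measure.map (fun ω => fun m : Λ => p (↑m + j) ω) P =
      Measure.map (fun ω => fun m : Λ => p ↑m ω) P)
    (U : Ω → EuclideanSpace ℝ (Fin d))
    (hUmeas : Measurable U)
    (hU : Measure.map U P = (volume (DD a))⁻¹ • volume.restrict (DD a))
    (hindep : IndepFun U (fun ω => fun m : Fin d → ℤ => p m ω) P)
    (K : ℝ) (hK : 0 ≤ K) (r : ℝ) (hr : 1 ≤ r)
    (hKr : ∑' k, GG r (LL a k) ≤ volume (DD a) * ENNReal.ofReal
        (((volume (Metric.closedBall (0 : EuclideanSpace ℝ (Fin d)) r)).toReal /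
          (volume (DD a)).toReal) ^ 2 + K * r ^ (d - 1)))
    (hfin : ∑' k, (xx P a p r k - yy P a p r k) / VV d r ≠ ∞) :
    ENNReal.ofReal (variance (fun ω => (NN a p U r ω).toReal) P) / VV d r ≤
      (volume (DD a))⁻¹ * ∑' k, (xx P a p r k - yy P a p r k) / VV d r +
        ENNReal.ofReal (K * r ^ (d - 1)) / VV d r := by
  have hr0 : 0 < r := by linarith
  set v := volume (DD a) with hv
  have hv0 : v ≠ 0 := DD_ne_zero a ha
  have hvt : v ≠ ∞ := DD_ne_top a ha
  set c := (VV d r).toReal / v.toReal with hc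
  change _ ≤ v * ENNReal.ofReal (c ^ 2 + K * r ^ (d - 1)) at hKr
  have hdiff : ∑' k, (xx P a p r k - yy P a p r k) / VV d r =
      (∑' k, (xx P a p r k - yy P a p r k)) / VV d r := by
    simp_rw [div_eq_mul_inv]
    rw [ENNReal.tsum_mul_right]
  rw [hdiff] at hfin ⊢
  set S := ∑' k, (xx P a p r k - yy P a p r k) with hS
  have hSfin : S ≠ ∞ := by
    intro h
    rw [h] at hfin
    exact hfin (ENNReal.top_div_of_ne_top (VV_ne_top r))
  have hM := NN_meas a p U hpm hUmeas r
  have hM2 : ∫⁻ ω, NN a p U r ω ^ 2 ∂P ≤ v⁻¹ * S + ENNReal.ofReal (K * r ^ (d - 1)) +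
      ENNReal.ofReal (c ^ 2) := by
    rw [second_moment P a ha p hpm hstat U hUmeas hU hindep r]
    calc v⁻¹ * ∑' k, xx P a p r k ≤ v⁻¹ * ∑' k, ((xx P a p r k - yy P a p r k) + yy P a p r k) := by
          gcongr with k
          exact le_tsub_add
      _ = v⁻¹ * S + v⁻¹ * ∑' k, yy P a p r k := by rw [ENNReal.tsum_add, mul_add]
      _ ≤ v⁻¹ * S + v⁻¹ * (v * ENNReal.ofReal (c ^ 2 + K * r ^ (d - 1))) := by
          gcongr
          exact (yy_sum P a ha p hpm hstat r).trans hKr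
      _ = v⁻¹ * S + ENNReal.ofReal (c ^ 2 + K * r ^ (d - 1)) := by
          rw [← mul_assoc, ENNReal.inv_mul_cancel hv0 hvt, one_mul]
      _ = _ := by
          rw [ENNReal.ofReal_add (sq_nonneg c) (by positivity)]; ring
  have hM2fin : ∫⁻ ω, NN a p U r ω ^ 2 ∂P ≠ ∞ := by
    refine ne_top_of_le_ne_top ?_ hM2
    exact ENNReal.add_ne_top.2 ⟨ENNReal.add_ne_top.2 ⟨ENNReal.mul_ne_top
      (ENNReal.inv_ne_top.2 hv0) hSfin, ENNReal.ofReal_ne_top⟩, ENNReal.ofReal_ne_top⟩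
  have hfm := first_moment P a ha p hpm hstat U hUmeas hU hindep r
  have hM1fin : ∫⁻ ω, NN a p U r ω ∂P ≠ ∞ := by
    rw [hfm]; exact ENNReal.mul_ne_top (ENNReal.inv_ne_top.2 hv0) (VV_ne_top r)
  have hE1 : ∫ ω, (NN a p U r ω).toReal ∂P = c := by
    rw [integral_toReal hM.aemeasurable (ae_lt_top hM hM1fin), hfm, ENNReal.toReal_mul,
      ENNReal.toReal_inv, hc, div_eq_inv_mul]
  have hE2 : ∫ ω, (NN a p U r ω).toReal ^ 2 ∂P = (∫⁻ ω, NN a p U r ω ^ 2 ∂P).toReal := by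
    rw [← integral_toReal (hM.pow_const 2).aemeasurable (ae_lt_top (hM.pow_const 2) hM2fin)]
    simp_rw [ENNReal.toReal_pow]
  have hL2 : MemLp (fun ω => (NN a p U r ω).toReal) 2 P := by
    rw [memLp_two_iff_integrable_sq hM.ennreal_toReal.aestronglyMeasurable]
    simp_rw [← ENNReal.toReal_pow]
    exact integrable_toReal_of_lintegral_ne_top (hM.pow_const 2).aemeasurable hM2fin
  have hvar : variance (fun ω => (NN a p U r ω).toReal) P =
      (∫⁻ ω, NN a p U r ω ^ 2 ∂P).toReal - c ^ 2 := by
    rw [variance_eq_sub hL2]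
    simp only [Pi.pow_apply]
    rw [hE1, hE2]
  have hle : ENNReal.ofReal (variance (fun ω => (NN a p U r ω).toReal) P) ≤
      v⁻¹ * S + ENNReal.ofReal (K * r ^ (d - 1)) := by
    rw [hvar, ENNReal.ofReal_sub _ (sq_nonneg c), ENNReal.ofReal_toReal hM2fin, tsub_le_iff_right]
    exact hM2
  calc _ ≤ (v⁻¹ * S + ENNReal.ofReal (K * r ^ (d - 1))) / VV d r := by gcongr
    _ = _ := by rw [ENNReal.add_div, mul_div_assoc]

lemma tail_lim (hd : 1 ≤ d) (K : ℝ) (hK : 0 ≤ K) :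
    Tendsto (fun r => ENNReal.ofReal (K * r ^ (d - 1)) / VV d r) atTop (nhds 0) := by
  have h1 : Tendsto (fun r : ℝ => ENNReal.ofReal (K / r) / VV d 1) atTop (nhds 0) := by
    have h2 : Tendsto (fun r : ℝ => K / r) atTop (nhds 0) :=
      tendsto_const_nhds.div_atTop tendsto_id
    have h3 := ENNReal.tendsto_ofReal h2
    have h4 := ENNReal.Tendsto.div_const h3 (b := VV d 1) (Or.inr VV_one_pos)
    simpa using h4
  refine h1.congr' ?_
  filter_upwards [eventually_gt_atTop 0] with r hr
  rw [VV_eq r hr.le, ENNReal.div_eq_div_iff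
    (by rw [← VV_eq r hr.le]; exact VV_ne_zero r hr) (by rw [← VV_eq r hr.le]; exact VV_ne_top r)
    VV_one_pos (VV_ne_top 1)]
  have : ENNReal.ofReal (r ^ d) * ENNReal.ofReal (K / r) = ENNReal.ofReal (K * r ^ (d - 1)) := by
    rw [← ENNReal.ofReal_mul (by positivity)]
    congr 1
    obtain ⟨e, rfl⟩ : ∃ e, d = e + 1 := ⟨d - 1, by omega⟩
    rw [Nat.add_sub_cancel, pow_succ]
    field_simp
  rw [← this]; ring

theorem main_aux
    {Ω : Type*} [MeasurableSpace Ω] (P : Measure Ω) [IsProbabilityMeasure P] (hd : 1 ≤ d)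
    (a : Fin d → EuclideanSpace ℝ (Fin d)) (ha : LinearIndependent ℝ a)
    (p : (Fin d → ℤ) → Ω → EuclideanSpace ℝ (Fin d))
    (hpm : ∀ m, Measurable (p m))
    (hstat : ∀ (j : Fin d → ℤ) (Λ : Finset (Fin d → ℤ)),
      Measure.map (fun ω => fun m : Λ => p (↑m + j) ω) P =
      Measure.map (fun ω => fun m : Λ => p ↑m ω) P)
    (U : Ω → EuclideanSpace ℝ (Fin d))
    (hUmeas : Measurable U)
    (hU : Measure.map U P = (volume (DD a))⁻¹ • volume.restrict (DD a))
    (hindep : IndepFun U (fun ω => fun m : Fin d → ℤ => p m ω) P)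
    (hsum : Summable fun k => mixCoef P (LL a) p ‖LL a k‖) :
    Tendsto (fun r : ℝ => variance (fun ω => (NN a p U r ω).toReal) P / (VV d r).toReal)
      atTop (nhds 0) := by
  obtain ⟨K, hK, hKb⟩ := lattice_bound hd a ha
  have hdel := delta_lim P a p hpm hsum
  have hvinv : (volume (DD a))⁻¹ ≠ ∞ := ENNReal.inv_ne_top.2 (DD_ne_zero a ha)
  have hb := (ENNReal.Tendsto.const_mul hdel (Or.inr hvinv)).add (tail_lim hd K hK)
  rw [mul_zero, add_zero] at hb
  have hE : Tendsto (fun r : ℝ => ENNReal.ofReal (variance (fun ω => (NN a p U r ω).toReal) P)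
      / VV d r) atTop (nhds 0) := by
    refine tendsto_of_tendsto_of_tendsto_of_le_of_le' tendsto_const_nhds hb
      (Eventually.of_forall fun r => zero_le) ?_
    filter_upwards [eventually_ge_atTop 1, hdel.eventually_ne ENNReal.zero_ne_top] with r hr hne
    exact var_bound P a ha p hpm hstat U hUmeas hU hindep K hK r hr (hKb r hr) hne
  have hR := (ENNReal.tendsto_toReal ENNReal.zero_ne_top).comp hE
  rw [ENNReal.toReal_zero] at hR
  refine hR.congr fun r => ?_
  simp only [Function.comp, ENNReal.toReal_div]
  rw [ENNReal.toReal_ofReal (variance_nonneg _ _)]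

end HU

theorem statement0
    {Ω : Type*} [MeasurableSpace Ω] (P : Measure Ω) [IsProbabilityMeasure P]
    (d : ℕ) (hd : 1 ≤ d)
    -- the lattice 𝓛, generated by a basis `a` of ℝ^d
    (a : Fin d → EuclideanSpace ℝ (Fin d))
    (ha : LinearIndependent ℝ a)
    (Lpt : (Fin d → ℤ) → EuclideanSpace ℝ (Fin d))
    (hLpt : ∀ m, Lpt m = ∑ i, (m i : ℝ) • a i)
    -- the fundamental domain 𝒟
    (D : Set (EuclideanSpace ℝ (Fin d)))
    (hD : D = {x | ∃ t : Fin d → ℝ, (∀ i, t i ∈ Set.Ico (0:ℝ) 1) ∧ x = ∑ i, t i • a i})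
    -- the random field of perturbations
    (p : (Fin d → ℤ) → Ω → EuclideanSpace ℝ (Fin d))
    (hpm : ∀ m, Measurable (p m))
    -- strict stationarity of the field
    (hstat : ∀ (j : Fin d → ℤ) (Λ : Finset (Fin d → ℤ)),
      Measure.map (fun ω => fun m : Λ => p (↑m + j) ω) P =
      Measure.map (fun ω => fun m : Λ => p ↑m ω) P)
    -- U uniform on 𝒟, independent of the field
    (U : Ω → EuclideanSpace ℝ (Fin d))
    (hUmeas : Measurable U)
    (hU : Measure.map U P = (volume D)⁻¹ • volume.restrict D)
    (hindep : IndepFun U (fun ω => fun m : Fin d → ℤ => p m ω) P)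
    -- moment and mixing assumptions: ∃ s > 0, q ≥ d, 1/s + 1/q = 1, E|p₀|^q < ∞,
    -- ∑_{i ∈ 𝓛} α(|i|)^{1/s} < ∞
    (s q : ℝ) (hs : 0 < s) (hq : (d : ℝ) ≤ q) (hsq : 1/s + 1/q = 1)
    (hmom : ∫⁻ ω, (‖p 0 ω‖₊ : ENNReal) ^ q ∂P < ⊤)
    (hsum : Summable (fun m : Fin d → ℤ => (mixCoef P Lpt p ‖Lpt m‖) ^ (1/s)))
    -- the number of points of the perturbed lattice Ξ in the closed ball B_r
    (N : ℝ → Ω → ℝ)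
    (hN : ∀ r ω, N r ω = ∑' m : Fin d → ℤ,
      (Metric.closedBall (0 : EuclideanSpace ℝ (Fin d)) r).indicator (fun _ => (1:ℝ))
        (Lpt m + p m ω + U ω)) :
    -- Ξ is hyperuniform
    Tendsto (fun r : ℝ =>
      variance (N r) P /
        (volume (Metric.closedBall (0 : EuclideanSpace ℝ (Fin d)) r)).toReal)
      atTop (nhds 0) := by
  obtain rfl : Lpt = HU.LL a := funext hLpt
  obtain rfl : D = HU.DD a := hD
  have hq1 : 1 ≤ q := le_trans (by exact_mod_cast hd) hq
  have hs1 : 1 / s ≤ 1 := by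
    have : 0 ≤ 1 / q := by positivity
    linarith
  have hsum' : Summable fun k => mixCoef P (HU.LL a) p ‖HU.LL a k‖ := by
    refine Summable.of_nonneg_of_le (fun k => HU.mixCoef_nonneg P _ _ _) (fun k => ?_) hsum
    have h := Real.rpow_le_rpow_of_exponent_ge' (HU.mixCoef_nonneg P (HU.LL a) p ‖HU.LL a k‖)
      (HU.mixCoef_le P (HU.LL a) p ‖HU.LL a k‖) (by positivity : 0 ≤ 1 / s) hs1
    rwa [Real.rpow_one] at h
  have hmain := HU.main_aux P hd a ha p hpm hstat U hUmeas hU hindep hsum'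
  have hNN : ∀ r, N r = fun ω => (HU.NN a p U r ω).toReal := by
    intro r
    funext ω
    rw [hN, HU.NN, ENNReal.tsum_toReal_eq
      (fun m => ne_top_of_le_ne_top ENNReal.one_ne_top (HU.ind_le r _))]
    refine tsum_congr fun m => ?_
    rw [← HU.ofReal_rin, ENNReal.toReal_ofReal (HU.rin_nonneg r _)]
    rfl
  refine hmain.congr fun r => ?_
  rw [hNN r]
  rfl
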